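/- arXiv:2104.12504 — 3 statements merged into one kernel-verified Lean document; each statement's English description precedes it below -/
import Mathlib

section
/- (Kolchin–Ostrowski) Let E = F(θ₁, …, θₙ) be a differential field extension of a differential field F of characteristic zero such that θᵢ' ∈ F for each i and the constants of E equal the constants of F. If y ∈ E satisfies y' ∈ F, then y = Σᵢ cᵢ·θᵢ + η for some constants c₁,…,cₙ and some η ∈ F. -/
open Polynomial

/-- The polynomial computing the derivative of `P(t)`. -/
lemma ko_exD {E : Type*} [Field E] [CharZero E] (δ : Derivation ℚ E E)
    (F : Subfield E) (hFδ : ∀ y ∈ F, δ y ∈ F) (t : E) (ht : δ t ∈ F) (P : F[X]) :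
    ∃ D : F[X], δ (aeval t P) = aeval t D ∧
      ∀ i, (D.coeff i : E) = δ (P.coeff i) + ((i : E) + 1) * P.coeff (i + 1) * δ t := by
  induction P using Polynomial.induction_on' with
  | add p q hp hq =>
    obtain ⟨D, h1, h2⟩ := hp
    obtain ⟨D', h1', h2'⟩ := hq
    refine ⟨D + D', by simp [h1, h1'], fun i => ?_⟩
    simp only [coeff_add, Subfield.coe_add, h2, h2', map_add]
    ring
  | monomial n a =>
    refine ⟨monomial n ⟨δ a, hFδ _ a.2⟩ + C ⟨δ t, ht⟩ * derivative (monomial n a), ?_, fun i => ?_⟩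
    · have e : ∀ x : F, algebraMap F E x = (x : E) := fun _ => rfl
      simp only [aeval_monomial, map_add, map_mul, aeval_C, derivative_monomial, e,
        Derivation.leibniz, Derivation.leibniz_pow, smul_eq_mul, nsmul_eq_mul,
        Subfield.coe_mul, map_natCast]
      push_cast
      ring
    · rw [coeff_add, coeff_C_mul, coeff_derivative]
      simp only [coeff_monomial]
      push_cast
      split_ifs <;> simp <;> ring

lemma ko_monic {E : Type*} [Field E] [CharZero E] (δ : Derivation ℚ E E)
    (F : Subfield E) (hFδ : ∀ y ∈ F, δ y ∈ F) (hconst : ∀ a : E, δ a = 0 → a ∈ F)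
    (t : E) (ht : δ t ∈ F) (htF : t ∉ F) (a b : E) (n : ℕ) (ha : a ∈ F) (hb : b ∈ F)
    (hb0 : b ≠ 0) (hbc : δ b = 0) : δ a + ((n : E) + 1) * b * δ t ≠ 0 := by
  intro h
  have hn : ((n : E) + 1) ≠ 0 := Nat.cast_add_one_ne_zero n
  have hnF : ((n : E) + 1) ∈ F := add_mem (natCast_mem F n) (one_mem F)
  have h1 : a + ((n : E) + 1) * b * t ∈ F := by
    apply hconst
    rw [← h]
    simp [hbc]
  have h2 : ((n : E) + 1) * b * t ∈ F := by
    simpa using sub_mem h1 ha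
  apply htF
  have h3 : t = (((n : E) + 1) * b)⁻¹ * (((n : E) + 1) * b * t) := by
    field_simp
  rw [h3]
  exact mul_mem (inv_mem (mul_mem hnF hb)) h2

/-- Derivative of a monic polynomial of positive degree: nonzero, of smaller degree. -/
lemma ko_D {E : Type*} [Field E] [CharZero E] (δ : Derivation ℚ E E)
    (F : Subfield E) (hFδ : ∀ y ∈ F, δ y ∈ F) (hconst : ∀ a : E, δ a = 0 → a ∈ F)
    (t : E) (ht : δ t ∈ F) (htF : t ∉ F) (Q : F[X]) (hQ : Q.Monic) (hd : 0 < Q.natDegree) :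
    ∃ D : F[X], δ (aeval t Q) = aeval t D ∧ D ≠ 0 ∧ D.natDegree < Q.natDegree := by
  obtain ⟨D, h1, h2⟩ := ko_exD δ F hFδ t ht Q
  refine ⟨D, h1, ?_, ?_⟩
  · rintro rfl
    obtain ⟨n, hn⟩ := Nat.exists_eq_succ_of_ne_zero hd.ne'
    have := h2 n
    have hq : Q.coeff (n + 1) = 1 := by rw [← Nat.succ_eq_add_one, ← hn]; exact hQ
    refine ko_monic δ F hFδ hconst t ht htF (Q.coeff n) (Q.coeff (n+1)) n (Subtype.property _)
      (Subtype.property _) (by simp [hq]) (by simp [hq]) ?_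
    rw [← this]; simp
  · by_contra hlt
    rw [not_lt] at hlt
    have hz : D.coeff D.natDegree = 0 := by
      apply Subtype.ext
      rw [h2, coeff_eq_zero_of_natDegree_lt (show Q.natDegree < D.natDegree + 1 by omega)]
      rcases hlt.eq_or_lt with h | h
      · rw [← h, show Q.coeff Q.natDegree = 1 from hQ]; simp
      · rw [coeff_eq_zero_of_natDegree_lt h]; simp
    have hD0 : D = 0 := leadingCoeff_eq_zero.mp hz
    rw [hD0, natDegree_zero] at hlt
    omega

lemma ko_transc {E : Type*} [Field E] [CharZero E] (δ : Derivation ℚ E E)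
    (F : Subfield E) (hFδ : ∀ y ∈ F, δ y ∈ F) (hconst : ∀ a : E, δ a = 0 → a ∈ F)
    (t : E) (ht : δ t ∈ F) (htF : t ∉ F) (P : F[X]) (hP : aeval t P = 0) : P = 0 := by
  by_contra hP0
  have hi : IsIntegral F t := IsAlgebraic.isIntegral ⟨P, hP0, hP⟩
  obtain ⟨D, h1, h2, h3⟩ := ko_D δ F hFδ hconst t ht htF (minpoly F t) (minpoly.monic hi)
    (minpoly.natDegree_pos hi)
  rw [minpoly.aeval, map_zero] at h1
  exact absurd (natDegree_le_natDegree (minpoly.degree_le_of_ne_zero F t h2 h1.symm)) (not_le.mpr h3)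

lemma ko_poly {E : Type*} [Field E] [CharZero E] (δ : Derivation ℚ E E)
    (F : Subfield E) (hFδ : ∀ y ∈ F, δ y ∈ F) (hconst : ∀ a : E, δ a = 0 → a ∈ F)
    (t : E) (ht : δ t ∈ F) (htF : t ∉ F) (y : E) (hy : δ y ∈ F) (n : ℕ) :
    ∀ Q P : F[X], Q ≠ 0 → Q.natDegree = n → y * aeval t Q = aeval t P →
      ∃ R : F[X], y = aeval t R := by
  induction n using Nat.strong_induction_on with
  | _ n ih =>
  intro Q P hQ0 hQn h
  set Q' := Q * C Q.leadingCoeff⁻¹ with hQ'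
  have hQm : Q'.Monic := monic_mul_leadingCoeff_inv hQ0
  have hlc : Q.leadingCoeff ≠ 0 := leadingCoeff_ne_zero.mpr hQ0
  have hdeg : Q'.natDegree = n := by
    rw [hQ', natDegree_mul_C (inv_ne_zero hlc), hQn]
  have h' : y * aeval t Q' = aeval t (P * C Q.leadingCoeff⁻¹) := by
    rw [hQ', map_mul, map_mul, ← h]; ring
  generalize P * C Q.leadingCoeff⁻¹ = P' at h'
  clear_value Q'
  rcases Nat.eq_zero_or_pos n with rfl | hn
  · rw [hQm.natDegree_eq_zero.mp hdeg] at h'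
    exact ⟨P', by simpa using h'⟩
  · obtain ⟨D, h1, h2, h3⟩ := ko_D δ F hFδ hconst t ht htF Q' hQm (hdeg ▸ hn)
    obtain ⟨D', h1', -⟩ := ko_exD δ F hFδ t ht P'
    refine ih _ (hdeg ▸ h3) D (D' - C ⟨δ y, hy⟩ * Q') h2 rfl ?_
    have h4 := congrArg δ h'
    rw [Derivation.leibniz, h1, h1', smul_eq_mul, smul_eq_mul] at h4
    rw [map_sub, map_mul, aeval_C, ← h4]
    change _ = _ - δ y * _
    ring

lemma ko_one {E : Type*} [Field E] [CharZero E] (δ : Derivation ℚ E E)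
    (F : Subfield E) (hFδ : ∀ y ∈ F, δ y ∈ F) (hconst : ∀ a : E, δ a = 0 → a ∈ F)
    (t : E) (ht : δ t ∈ F) (y : E) (hy : δ y ∈ F)
    (hyt : y ∈ Subfield.closure ((F : Set E) ∪ {t})) :
    ∃ c η : E, δ c = 0 ∧ η ∈ F ∧ y = c * t + η := by
  by_cases htF : t ∈ F
  · refine ⟨0, y, by simp, ?_, by simp⟩
    have : Subfield.closure ((F : Set E) ∪ {t}) ≤ F := by
      rw [Subfield.closure_le]; simp [Set.insert_subset_iff, htF]
    exact this hyt
  have hy1 : y ∈ IntermediateField.adjoin F {t} := by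
    have : Subfield.closure ((F : Set E) ∪ {t}) ≤ (IntermediateField.adjoin F {t}).toSubfield := by
      rw [Subfield.closure_le]
      rintro x (hx | hx)
      · exact (IntermediateField.adjoin F {t}).algebraMap_mem ⟨x, hx⟩
      · exact IntermediateField.subset_adjoin _ _ hx
    exact this hyt
  obtain ⟨R, hR⟩ : ∃ R : F[X], y = aeval t R := by
    obtain ⟨r, s, hrs⟩ := (IntermediateField.mem_adjoin_simple_iff _ _).mp hy1
    by_cases hs : aeval t s = 0
    · exact ⟨0, by simp [hrs, hs]⟩
    · refine ko_poly δ F hFδ hconst t ht htF y hy _ s r ?_ rfl ?_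
      · rintro rfl; simp at hs
      · rw [hrs]; field_simp
  obtain ⟨D, h1, h2⟩ := ko_exD δ F hFδ t ht R
  have hD : D = C ⟨δ y, hy⟩ := by
    rw [← sub_eq_zero]
    apply ko_transc δ F hFδ hconst t ht htF
    rw [map_sub, aeval_C, ← h1, ← hR]
    exact sub_self _
  have hdeg : R.natDegree ≤ 1 := by
    by_contra hlt
    obtain ⟨n, hn⟩ : ∃ n, R.natDegree = n + 2 := ⟨R.natDegree - 2, by omega⟩
    have e1 := h2 (n + 2)
    have e2 := h2 (n + 1)
    have hz : R.coeff (n + 2 + 1) = 0 := coeff_eq_zero_of_natDegree_lt (by omega)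
    rw [hD, coeff_C, if_neg (by omega)] at e1 e2
    rw [hz] at e1
    have hl : R.coeff (n + 2) ≠ 0 := by
      rw [← hn]
      exact leadingCoeff_ne_zero.mpr (by rintro rfl; simp at hn)
    refine ko_monic δ F hFδ hconst t ht htF (R.coeff (n+1)) (R.coeff (n+1+1)) (n+1)
      (Subtype.property _) (Subtype.property _) (by simpa using hl) (by simpa using e1.symm) ?_
    rw [← e2]; simp
  have hc := h2 1
  rw [hD, coeff_C, if_neg one_ne_zero, coeff_eq_zero_of_natDegree_lt (show R.natDegree < 1 + 1 by omega)] at hc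
  refine ⟨R.coeff 1, R.coeff 0, by simpa using hc.symm, Subtype.property _, ?_⟩
  rw [hR]
  conv_lhs => rw [eq_X_add_C_of_natDegree_le_one hdeg]
  simp only [map_add, map_mul, aeval_C, aeval_X]
  rfl

lemma ko_stable {E : Type*} [Field E] [CharZero E] (δ : Derivation ℚ E E)
    (F : Subfield E) (hFδ : ∀ y ∈ F, δ y ∈ F) (S : Set E) (hS : ∀ s ∈ S, δ s ∈ F) :
    ∀ y ∈ Subfield.closure ((F : Set E) ∪ S), δ y ∈ Subfield.closure ((F : Set E) ∪ S) := by
  have hF : ∀ x ∈ F, x ∈ Subfield.closure ((F : Set E) ∪ S) := fun x hx =>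
    Subfield.subset_closure (Or.inl hx)
  intro y hy
  induction hy using Subfield.closure_induction with
  | mem x hx =>
    rcases hx with hx | hx
    · exact hF _ (hFδ x hx)
    · exact hF _ (hS x hx)
  | one => simp
  | add x y hx hy h1 h2 => rw [map_add]; exact add_mem h1 h2
  | neg x hx h => rw [map_neg]; exact neg_mem h
  | inv x hx h =>
    rw [Derivation.leibniz_inv, smul_eq_mul]
    exact mul_mem (neg_mem (pow_mem (inv_mem hx) 2)) h
  | mul x y hx hy h1 h2 =>
    rw [Derivation.leibniz, smul_eq_mul, smul_eq_mul]
    exact add_mem (mul_mem hx h2) (mul_mem hy h1)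

lemma ko_main {E : Type*} [Field E] [CharZero E] (δ : Derivation ℚ E E)
    (F : Subfield E) (hFδ : ∀ y ∈ F, δ y ∈ F) (hconst : ∀ a : E, δ a = 0 → a ∈ F) (n : ℕ) :
    ∀ (θ : Fin n → E) (_ : ∀ i, δ (θ i) ∈ F) (y : E) (_ : δ y ∈ F)
    (_ : y ∈ Subfield.closure ((F : Set E) ∪ Set.range θ)),
    ∃ (c : Fin n → E) (η : E), (∀ i, δ (c i) = 0) ∧ η ∈ F ∧
      y = (∑ i, c i * θ i) + η := by
  induction n with
  | zero =>
    intro θ _ y _ hyc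
    exact ⟨0, y, by simp, by simpa using hyc, by simp⟩
  | succ n ih =>
    intro θ hθ y hy hyc
    set K := Subfield.closure ((F : Set E) ∪ Set.range (fun i : Fin n => θ i.castSucc)) with hK
    have hFK : ∀ x ∈ F, x ∈ K := fun x hx => Subfield.subset_closure (Or.inl hx)
    have hKδ : ∀ y ∈ K, δ y ∈ K := ko_stable δ F hFδ _ (by rintro _ ⟨i, rfl⟩; exact hθ _)
    obtain ⟨c, η, hc, hη, e⟩ := ko_one δ K hKδ (fun a ha => hFK _ (hconst a ha))
      (θ (Fin.last n)) (hFK _ (hθ _)) y (hFK _ hy) (by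
        refine (Subfield.closure_le.mpr ?_ : Subfield.closure ((F : Set E) ∪ Set.range θ) ≤ _) hyc
        rintro x (hx | ⟨i, rfl⟩)
        · exact Subfield.subset_closure (Or.inl (hFK _ hx))
        · induction i using Fin.lastCases with
          | last => exact Subfield.subset_closure (Or.inr rfl)
          | cast i =>
            exact Subfield.subset_closure (Or.inl (Subfield.subset_closure (Or.inr ⟨i, rfl⟩))))
    have hη' : δ η ∈ F := by
      have : δ η = δ y - c * δ (θ (Fin.last n)) := by
        rw [e]; simp [hc]
      rw [this]
      exact sub_mem hy (mul_mem (hconst c hc) (hθ _))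
    obtain ⟨d, ζ, hd, hζ, e'⟩ := ih (fun i => θ i.castSucc) (fun i => hθ _) η hη' hη
    refine ⟨Fin.snoc d c, ζ, ?_, hζ, ?_⟩
    · intro i
      induction i using Fin.lastCases with
      | last => simpa using hc
      | cast i => simpa using hd i
    · rw [Fin.sum_univ_castSucc]
      simp only [Fin.snoc_castSucc, Fin.snoc_last]
      rw [e, e']; ring

/-- Kolchin–Ostrowski: if `E = F(θ₁,…,θₙ)` with each `θᵢ' ∈ F` and
`C_E = C_F`, then every `y ∈ E` with `y' ∈ F` has the form
`y = Σ cᵢ·θᵢ + η` with the `cᵢ` constants and `η ∈ F`. -/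
theorem stmt10 {E : Type*} [Field E] [CharZero E] (δ : Derivation ℚ E E)
    (F : Subfield E) (hFδ : ∀ y ∈ F, δ y ∈ F)
    {n : ℕ} (θ : Fin n → E) (hθ : ∀ i, δ (θ i) ∈ F)
    (hgen : Subfield.closure ((F : Set E) ∪ Set.range θ) = ⊤)
    (hconst : ∀ a : E, δ a = 0 → a ∈ F)
    (y : E) (hy : δ y ∈ F) :
    ∃ (c : Fin n → E) (η : E), (∀ i, δ (c i) = 0) ∧ η ∈ F ∧
      y = (∑ i, c i * θ i) + η := by
  exact ko_main δ F hFδ hconst n θ hθ y hy (by rw [hgen]; trivial)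
end

section
/- Let F be a differential field of characteristic zero and let E = F(θ₁,…,θₙ) be a transcendental dilogarithmic-elementary extension of F with C_E = C_F. If u ∈ E satisfies u' ∈ F, then there exist a finite index set I, elements r_i, w ∈ F, elements g_i ∈ F \ {0,1}, and constants c_i, c_{ij} with c_{ij} = c_{ji}, such that u' = Σ_{i∈I} r_i·(g_i'/g_i) + w' and r_i' = c_i·(1-g_i)'/(1-g_i) + Σ_{j∈I} c_{ij}·(g_j'/g_j). Conversely, if u' ∈ F admits such an expression, then u' has an antiderivative in some transcendental dilogarithmic-elementary extension of F with the same constants. -/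
universe u

/-- `θ` is a transcendental dilogarithmic-elementary generator over the base
subfield `B`: `θ` is transcendental over `B` and is an exponential, a
logarithm, or a dilogarithm of an element of `B`. -/
def IsTransDilogElemGen {E : Type u} [Field E] [CharZero E]
    (δ : Derivation ℚ E E) (B : Subfield E) (θ : E) : Prop :=
  Transcendental (↥B) θ ∧
    ((∃ a ∈ B, δ θ = δ a * θ) ∨
     (∃ a ∈ B, a ≠ 0 ∧ δ θ = δ a / a) ∨
     (∃ g ∈ B, g ≠ 0 ∧ g ≠ 1 ∧ ∃ η ∈ B,
        δ η = -(δ (1 - g) / (1 - g)) ∧ δ θ = (δ g / g) * η))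

/-- `E = F(θ₁,…,θₙ)` is a transcendental dilogarithmic-elementary tower over
the subfield `F`. -/
def IsTransDilogElemTower {E : Type u} [Field E] [CharZero E]
    (δ : Derivation ℚ E E) (F : Subfield E) {n : ℕ} (θ : Fin n → E) : Prop :=
  (∀ i : Fin n,
      IsTransDilogElemGen δ
        (Subfield.closure ((F : Set E) ∪ θ '' {j : Fin n | j < i})) (θ i)) ∧
    Subfield.closure ((F : Set E) ∪ Set.range θ) = ⊤

set_option linter.unusedSectionVars false


namespace Dilog

abbrev Der (K : Type u) [Field K] [CharZero K] := Derivation ℚ K K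

/-- build a derivation from an additive map satisfying Leibniz -/
noncomputable def mkDer {K : Type u} [Field K] [CharZero K] (f : K → K)
    (hadd : ∀ x y, f (x + y) = f x + f y) (hmul : ∀ x y, f (x * y) = x * f y + y * f x) :
    Der K :=
  Derivation.mk' ((AddMonoidHom.mk' f hadd).toRatLinearMap) (by
    intro a b
    simp [hmul])

@[simp] lemma mkDer_apply {K : Type u} [Field K] [CharZero K] (f : K → K) (hadd) (hmul) (x : K) :
    mkDer f hadd hmul x = f x := rfl

section basic
variable {K : Type u} [Field K] [CharZero K] (D : Der K)

lemma der_mul (x y : K) : D (x * y) = x * D y + y * D x := by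
  simp [Derivation.leibniz]

lemma der_one : D 1 = 0 := D.map_one_eq_zero

lemma der_const_mul {c : K} (hc : D c = 0) (x : K) : D (c * x) = c * D x := by
  simp [Derivation.leibniz, hc]

lemma der_inv (x : K) : D x⁻¹ = -(D x / x ^ 2) := by
  by_cases hx : x = 0
  · simp [hx]
  · have h : D (x * x⁻¹) = 0 := by rw [mul_inv_cancel₀ hx]; exact D.map_one_eq_zero
    rw [der_mul] at h
    field_simp at h ⊢
    linear_combination h

lemma der_div (x y : K) (hy : y ≠ 0) : D (x / y) = (D x * y - x * D y) / y ^ 2 := by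
  rw [div_eq_mul_inv, der_mul, der_inv]
  field_simp
  ring

lemma der_int (n : ℤ) : D (n : K) = 0 := D.map_intCast n

end basic

section laurent
variable {F : Type u} [Field F] [CharZero F]

instance : CharZero (HahnSeries ℤ F) :=
  charZero_of_injective_ringHom (f := (HahnSeries.C : F →+* HahnSeries ℤ F)) HahnSeries.C_injective

/-- general coefficientwise modification -/
noncomputable def lmap (e : ℤ → F → F) (he : ∀ n, e n 0 = 0) (x : HahnSeries ℤ F) : HahnSeries ℤ F where
  coeff n := e n (x.coeff n)
  isPWO_support' := x.isPWO_support.mono (by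
    intro n hn hx
    apply hn
    simp [hx, he])

lemma lmap_support (e : ℤ → F → F) (he) (x : HahnSeries ℤ F) :
    (lmap e he x).support ⊆ x.support := by
  intro n hn hx
  apply hn
  simp [hx, he, lmap]

/-- coefficient derivation plus `b`-twisted Euler derivation -/
lemma lmap_leibniz (e : ℤ → F → F) (he : ∀ n, e n 0 = 0)
    (hadd : ∀ n x y, e n (x + y) = e n x + e n y)
    (hmul : ∀ m n x y, e (m + n) (x * y) = x * e n y + y * e m x)
    (x y : HahnSeries ℤ F) :
    lmap e he (x * y) = x * lmap e he y + y * lmap e he x := by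
  ext n
  rw [mul_comm y, HahnSeries.coeff_add,
    HahnSeries.coeff_mul_right' y.isPWO_support (lmap_support e he y),
    HahnSeries.coeff_mul_left' x.isPWO_support (lmap_support e he x), ← Finset.sum_add_distrib]
  have key : e n ((x * y).coeff n) = ∑ ij ∈ Finset.antidiagonal x.isPWO_support y.isPWO_support n,
      e n (x.coeff ij.1 * y.coeff ij.2) := by
    rw [HahnSeries.coeff_mul]
    exact map_sum (AddMonoidHom.mk' (e n) (hadd n)) _ _
  refine key.trans (Finset.sum_congr rfl ?_)
  intro ij hij
  have h : ij.1 + ij.2 = n := by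
    simpa using (Finset.mem_antidiagonal.1 hij).2.2
  rw [← h, hmul]
  simp only [lmap]
  ring

/-- The derivation on Laurent series in `z = 1/t` with `z`-adic coefficients, extending `d`, with
`t' = b * t ^ (1 - ε)`. -/
noncomputable def lder (d : Der F) (ε : ℤ) (b : F) : Der (HahnSeries ℤ F) :=
  mkDer (fun x => lmap (fun _ a => d a) (by simp) x
      + HahnSeries.single ε b * lmap (fun n a => -(n : F) * a) (by simp) x)
    (by
      intro x y
      have h1 : lmap (fun _ a => d a) (by simp) (x + y) = lmap (fun _ a => d a) (by simp) x
          + lmap (fun _ a => d a) (by simp) y := by ext n; simp [lmap]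
      have h2 : lmap (fun n a => -(n : F) * a) (by simp) (x + y)
          = lmap (fun n a => -(n : F) * a) (by simp) x
          + lmap (fun n a => -(n : F) * a) (by simp) y := by ext n; simp [lmap]; ring
      rw [h1, h2]; ring)
    (by
      intro x y
      rw [lmap_leibniz (fun _ a => d a) (by simp) (by simp) (by intros; exact der_mul d _ _),
        lmap_leibniz (fun n a => -(n : F) * a) (by simp) (by intros; ring)
          (by intros; push_cast; ring)]
      ring)

lemma lder_coeff (d : Der F) (ε : ℤ) (b : F) (x : HahnSeries ℤ F) (n : ℤ) :
    (lder d ε b x).coeff n = d (x.coeff n) - ((n - ε : ℤ) : F) * b * x.coeff (n - ε) := by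
  simp only [lder, mkDer_apply, HahnSeries.coeff_add, HahnSeries.coeff_single_mul, lmap]
  ring

lemma lder_C (d : Der F) (ε : ℤ) (b : F) (a : F) :
    lder d ε b (HahnSeries.C a) = HahnSeries.C (d a) := by
  ext n
  rw [lder_coeff]
  by_cases hn : n = 0
  · subst hn
    by_cases he : ε = 0
    · subst he; simp
    · have : (HahnSeries.C a : HahnSeries ℤ F).coeff (0 - ε) = 0 := by
        rw [HahnSeries.C_apply, HahnSeries.coeff_single_of_ne]; omega
      rw [this]; simp
  · by_cases he : n - ε = 0
    · rw [he]; simp [HahnSeries.C_apply, HahnSeries.coeff_single_of_ne hn]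
    · simp [HahnSeries.C_apply, HahnSeries.coeff_single_of_ne hn, HahnSeries.coeff_single_of_ne he]

lemma lder_t (d : Der F) (ε : ℤ) (b : F) :
    lder d ε b (HahnSeries.single (-1 : ℤ) 1) = HahnSeries.single (ε - 1) b := by
  ext n
  rw [lder_coeff]
  by_cases hn : n = ε - 1
  · subst hn
    rw [HahnSeries.coeff_single_same]
    have h1 : ε - 1 - ε = -1 := by ring
    rw [h1, HahnSeries.coeff_single_same]
    have : d ((HahnSeries.single (-1 : ℤ) (1 : F)).coeff (ε - 1)) = 0 := by
      by_cases h : ε - 1 = -1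
      · rw [h, HahnSeries.coeff_single_same, der_one]
      · rw [HahnSeries.coeff_single_of_ne h, map_zero]
    rw [this]; push_cast; ring
  · rw [HahnSeries.coeff_single_of_ne hn,
      HahnSeries.coeff_single_of_ne (show n - ε ≠ -1 by omega)]
    by_cases h : n = -1
    · subst h; rw [HahnSeries.coeff_single_same, der_one]; simp
    · rw [HahnSeries.coeff_single_of_ne h]; simp

/-- product coefficients -/
lemma exists_ps (x : HahnSeries ℤ F) (m : ℤ) (hx : ∀ n < m, x.coeff n = 0) :
    ∃ p : PowerSeries F, x = HahnSeries.single m 1 * HahnSeries.ofPowerSeries ℤ F p := by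
  refine ⟨PowerSeries.mk fun n => x.coeff (m + n), ?_⟩
  ext n
  rw [HahnSeries.coeff_single_mul, one_mul]
  by_cases h : n < m
  · rw [hx n h, PowerSeries.coeff_coe, if_pos (by omega)]
  · rw [PowerSeries.coeff_coe, if_neg (by omega), PowerSeries.coeff_mk]
    congr 1; omega

lemma coeff_ps (m : ℤ) (p : PowerSeries F) (n : ℤ) (k : ℕ) (h : n = m + k) :
    (HahnSeries.single m 1 * HahnSeries.ofPowerSeries ℤ F p).coeff n = PowerSeries.coeff k p := by
  rw [HahnSeries.coeff_single_mul, one_mul, PowerSeries.coeff_coe, if_neg (by omega)]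
  congr; omega

lemma mul_coeffs (x y : HahnSeries ℤ F) (m k : ℤ) (hx : ∀ n < m, x.coeff n = 0)
    (hy : ∀ n < k, y.coeff n = 0) :
    (∀ n < m + k, (x * y).coeff n = 0) ∧ (x * y).coeff (m + k) = x.coeff m * y.coeff k ∧
    (x * y).coeff (m + k + 1) = x.coeff m * y.coeff (k + 1) + x.coeff (m + 1) * y.coeff k := by
  obtain ⟨p, rfl⟩ := exists_ps x m hx
  obtain ⟨q, rfl⟩ := exists_ps y k hy
  have : (HahnSeries.single m 1 * HahnSeries.ofPowerSeries ℤ F p) *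
      (HahnSeries.single k 1 * HahnSeries.ofPowerSeries ℤ F q) =
      HahnSeries.single (m + k) 1 * HahnSeries.ofPowerSeries ℤ F (p * q) := by
    rw [map_mul, ← one_mul (1 : F), ← HahnSeries.single_mul_single, one_mul]; ring
  rw [this]
  refine ⟨?_, ?_, ?_⟩
  · intro n hn
    rw [HahnSeries.coeff_single_mul, one_mul, PowerSeries.coeff_coe, if_pos (by omega)]
  · rw [coeff_ps _ _ _ 0 (by simp), coeff_ps _ _ _ 0 (by simp), coeff_ps _ _ _ 0 (by simp)]
    simp [PowerSeries.coeff_mul]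
  · rw [coeff_ps _ _ _ 1 (by simp), coeff_ps m p m 0 (by simp), coeff_ps k q k 0 (by simp),
      coeff_ps m p (m + 1) 1 (by simp), coeff_ps k q (k + 1) 1 (by simp), PowerSeries.coeff_mul,
      Finset.Nat.antidiagonal_succ]
    simp

end laurent
end Dilog

namespace Dilog
section laurent2
variable {F : Type u} [Field F] [CharZero F]

lemma order_eq_of (x : HahnSeries ℤ F) (m : ℤ) (h0 : x.coeff m ≠ 0)
    (h : ∀ n < m, x.coeff n = 0) : x.order = m := by
  apply le_antisymm (HahnSeries.order_le_of_coeff_ne_zero h0)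
  by_contra hlt
  push Not at hlt
  have hx : x ≠ 0 := by rintro rfl; simp at h0
  exact HahnSeries.coeff_order_eq_zero.not.2 hx (h _ hlt)

lemma coeff_one_ne (n : ℤ) (hn : n ≠ 0) : (1 : HahnSeries ℤ F).coeff n = 0 := by
  rw [HahnSeries.coeff_one, if_neg hn]

lemma pair_lemma (g : HahnSeries ℤ F) (h0 : g ≠ 0) :
    (g.coeff g.order = 1 ∧ g.order = 0) ∨
    ((1 - g).coeff (1 - g).order = - g.coeff g.order ∧ (1 - g).order = g.order) ∨
    ((1 - g).coeff (1 - g).order = 1 ∧ (1 - g).order = 0) ∨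
    (g.coeff g.order ≠ 1 ∧ (1 - g).coeff (1 - g).order = 1 - g.coeff g.order ∧ g.order = 0 ∧
      (1 - g).order = 0) := by
  have hne : g.coeff g.order ≠ 0 := HahnSeries.coeff_order_eq_zero.not.2 h0
  have hlt : ∀ n < g.order, g.coeff n = 0 := fun n hn => HahnSeries.coeff_eq_zero_of_lt_order hn
  rcases lt_trichotomy g.order 0 with h | h | h
  · right; left
    have e : (1 - g).order = g.order := by
      apply order_eq_of
      · rw [HahnSeries.coeff_sub, coeff_one_ne _ h.ne]; simpa using hne
      · intro n hn
        rw [HahnSeries.coeff_sub, coeff_one_ne _ (by omega), hlt n hn, sub_zero]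
    refine ⟨?_, e⟩
    rw [e, HahnSeries.coeff_sub, coeff_one_ne _ h.ne, zero_sub]
  · by_cases ha : g.coeff g.order = 1
    · exact Or.inl ⟨ha, h⟩
    · right; right; right
      have e : (1 - g).order = 0 := by
        apply order_eq_of
        · rw [HahnSeries.coeff_sub, HahnSeries.coeff_one, if_pos rfl, ← h, sub_ne_zero]
          exact Ne.symm ha
        · intro n hn
          rw [HahnSeries.coeff_sub, coeff_one_ne _ (by omega), hlt n (by omega), sub_zero]
      refine ⟨ha, ?_, h, e⟩
      rw [e, h, HahnSeries.coeff_sub, HahnSeries.coeff_one, if_pos rfl]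
  · right; right; left
    have h00 : (1 - g).coeff 0 = 1 := by
      rw [HahnSeries.coeff_sub, HahnSeries.coeff_one, if_pos rfl, hlt 0 h, sub_zero]
    have e : (1 - g).order = 0 := by
      apply order_eq_of
      · rw [h00]; exact one_ne_zero
      · intro n hn
        rw [HahnSeries.coeff_sub, coeff_one_ne _ (by omega), hlt n (by omega), sub_zero]
    exact ⟨by rw [e, h00], e⟩

lemma dlog_nonneg (d : Der F) (ε : ℤ) (hε : 0 ≤ ε) (b : F) (g : HahnSeries ℤ F) (hg : g ≠ 0) :
    ∀ n < 0, (lder d ε b g / g).coeff n = 0 := by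
  have hlt : ∀ n < g.order, g.coeff n = 0 := fun n hn => HahnSeries.coeff_eq_zero_of_lt_order hn
  intro n hn
  by_cases hH : lder d ε b g / g = 0
  · rw [hH]; simp
  apply HahnSeries.coeff_eq_zero_of_lt_order
  refine lt_of_lt_of_le hn ?_
  have hm : g * (lder d ε b g / g) = lder d ε b g := by field_simp
  have ho := HahnSeries.order_mul hg hH
  rw [hm] at ho
  have hD : lder d ε b g ≠ 0 := by rintro h; apply hH; rw [h, zero_div]
  by_contra hc
  push Not at hc
  have hz : (lder d ε b g).coeff (lder d ε b g).order = 0 := by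
    rw [lder_coeff, hlt _ (by omega), hlt _ (by omega)]; simp
  exact hD (HahnSeries.coeff_order_eq_zero.1 hz)

lemma dlog_coeffs (d : Der F) (ε : ℤ) (hε : 0 ≤ ε) (b : F) (g : HahnSeries ℤ F) (hg : g ≠ 0) :
    g.coeff g.order * (lder d ε b g / g).coeff 0 = (lder d ε b g).coeff g.order ∧
    g.coeff g.order * (lder d ε b g / g).coeff 1 + 
      g.coeff (g.order + 1) * (lder d ε b g / g).coeff 0 = (lder d ε b g).coeff (g.order + 1) := by
  have hlt : ∀ n < g.order, g.coeff n = 0 := fun n hn => HahnSeries.coeff_eq_zero_of_lt_order hn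
  have hm : g * (lder d ε b g / g) = lder d ε b g := by field_simp
  obtain ⟨-, h1, h2⟩ := mul_coeffs g (lder d ε b g / g) g.order 0 hlt (dlog_nonneg d ε hε b g hg)
  rw [hm] at h1 h2
  simp only [add_zero, zero_add] at h1 h2
  exact ⟨h1.symm, h2.symm⟩

lemma dlog_exp (d : Der F) (b : F) (g : HahnSeries ℤ F) (hg : g ≠ 0) :
    (lder d 0 b g / g).coeff 0 = d (g.coeff g.order) / g.coeff g.order - g.order * b := by
  have hne : g.coeff g.order ≠ 0 := HahnSeries.coeff_order_eq_zero.not.2 hg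
  have h := (dlog_coeffs d 0 le_rfl b g hg).1
  rw [lder_coeff, sub_zero] at h
  field_simp
  linear_combination h

lemma dlog_prim0 (d : Der F) (b : F) (g : HahnSeries ℤ F) (hg : g ≠ 0) :
    (lder d 1 b g / g).coeff 0 = d (g.coeff g.order) / g.coeff g.order := by
  have hne : g.coeff g.order ≠ 0 := HahnSeries.coeff_order_eq_zero.not.2 hg
  have h := (dlog_coeffs d 1 zero_le_one b g hg).1
  have h0 : g.coeff (g.order - 1) = 0 := HahnSeries.coeff_eq_zero_of_lt_order (by omega)
  rw [lder_coeff, h0] at h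
  field_simp
  linear_combination h

lemma dlog_prim1 (d : Der F) (b : F) (g : HahnSeries ℤ F) (hg : g ≠ 0) :
    ∃ l, (lder d 1 b g / g).coeff 1 = d l - g.order * b := by
  refine ⟨g.coeff (g.order + 1) / g.coeff g.order, ?_⟩
  have hne : g.coeff g.order ≠ 0 := HahnSeries.coeff_order_eq_zero.not.2 hg
  have h := (dlog_coeffs d 1 zero_le_one b g hg).2
  rw [dlog_prim0 d b g hg, lder_coeff, add_sub_cancel_right] at h
  rw [der_div _ _ _ hne]
  field_simp at h ⊢
  linear_combination h

/-- primitive case: a top-degree obstruction -/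
lemma prim_top (d : Der F) (b : F) (hb : ∀ y, d y ≠ b) (x : HahnSeries ℤ F) (hx : x ≠ 0)
    (h0 : x.order ≠ 0) (h1 : (lder d 1 b x).coeff x.order = 0)
    (h2 : (lder d 1 b x).coeff (x.order + 1) = 0) : False := by
  have hne : x.coeff x.order ≠ 0 := HahnSeries.coeff_order_eq_zero.not.2 hx
  have hz : x.coeff (x.order - 1) = 0 := HahnSeries.coeff_eq_zero_of_lt_order (by omega)
  have hn : (x.order : F) ≠ 0 := by exact_mod_cast h0
  rw [lder_coeff, hz] at h1
  rw [lder_coeff, add_sub_cancel_right] at h2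
  apply hb (x.coeff (x.order + 1) / ((x.order : F) * x.coeff x.order))
  have h3 : d ((x.order : F) * x.coeff x.order) = 0 := by
    rw [der_const_mul d (der_int d _)]
    have : d (x.coeff x.order) = 0 := by linear_combination h1
    rw [this, mul_zero]
  rw [der_div _ _ _ (mul_ne_zero hn hne), h3]
  field_simp
  linear_combination ((x.order : F) * x.coeff x.order) * h2

lemma prim_bound (d : Der F) (b : F) (hb : ∀ y, d y ≠ b) (x : HahnSeries ℤ F) (m : ℤ) (hm : m ≤ 0)
    (h : ∀ n < m, (lder d 1 b x).coeff n = 0) : ∀ n < m - 1, x.coeff n = 0 := by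
  intro n hn
  by_cases hx : x = 0
  · simp [hx]
  apply HahnSeries.coeff_eq_zero_of_lt_order
  by_contra hc
  push Not at hc
  exact prim_top d b hb x hx (by omega) (h _ (by omega)) (h _ (by omega))

lemma prim_const (d : Der F) (b : F) (hb : ∀ y, d y ≠ b) (x : HahnSeries ℤ F)
    (h : lder d 1 b x = 0) : d (x.coeff 0) = 0 ∧ x = HahnSeries.C (x.coeff 0) := by
  have key : ∀ y : HahnSeries ℤ F, lder d 1 b y = 0 → y ≠ 0 → y.order = 0 := by
    intro y hy hy0
    by_contra hc
    exact prim_top d b hb y hy0 hc (by rw [hy]; simp) (by rw [hy]; simp)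
  by_cases hx : x = 0
  · subst hx; simp
  have ho := key x h hx
  have hz : x.coeff (0 - 1) = 0 := HahnSeries.coeff_eq_zero_of_lt_order (by omega)
  have hd : d (x.coeff 0) = 0 := by
    have h2 : (lder d 1 b x).coeff 0 = 0 := by rw [h]; simp
    rw [lder_coeff, hz] at h2
    linear_combination h2
  refine ⟨hd, ?_⟩
  by_contra hne
  have hy : x - HahnSeries.C (x.coeff 0) ≠ 0 := sub_ne_zero.2 hne
  have hoy := key _ (by rw [map_sub, h, lder_C, hd]; simp) hy
  have := HahnSeries.coeff_order_eq_zero.not.2 hy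
  rw [hoy] at this
  simp at this

lemma exp_bound (d : Der F) (b : F) (hb : ∀ (m : ℤ) (y : F), m ≠ 0 → d y = m * b * y → y = 0)
    (x : HahnSeries ℤ F) (n : ℤ) (hn : n ≠ 0) (h : (lder d 0 b x).coeff n = 0) : x.coeff n = 0 := by
  rw [lder_coeff, sub_zero] at h
  exact hb n _ hn (by linear_combination h)

lemma exp_const (d : Der F) (b : F) (hb : ∀ (m : ℤ) (y : F), m ≠ 0 → d y = m * b * y → y = 0)
    (x : HahnSeries ℤ F) (h : lder d 0 b x = 0) :
    d (x.coeff 0) = 0 ∧ x = HahnSeries.C (x.coeff 0) := by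
  constructor
  · have h2 : (lder d 0 b x).coeff 0 = 0 := by rw [h]; simp
    rw [lder_coeff] at h2
    simpa using h2
  · ext n
    by_cases hn : n = 0
    · subst hn; simp
    · rw [exp_bound d b hb x n hn (by rw [h]; simp), HahnSeries.C_apply,
        HahnSeries.coeff_single_of_ne hn]

end laurent2
end Dilog

namespace Dilog
section rep
variable {F : Type u} [Field F] [CharZero F]

def Rep (δF : Der F) (v : F) : Prop :=
  ∃ (k : ℕ) (r g : Fin k → F) (w : F) (c : Fin k → F)
          (cc : Fin k → Fin k → F),
        (∀ i, g i ≠ 0 ∧ g i ≠ 1) ∧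
        (∀ i, δF (c i) = 0) ∧ (∀ i j, δF (cc i j) = 0) ∧
        (∀ i j, cc i j = cc j i) ∧
        v = (∑ i, r i * (δF (g i) / g i)) + δF w ∧
        ∀ i, δF (r i)
          = c i * (δF (1 - g i) / (1 - g i)) + ∑ j, cc i j * (δF (g j) / g j)

/-- relaxed representation -/
def RRep (d : Der F) (v : F) : Prop :=
  ∃ (ι : Type) (_ : Fintype ι) (r g : ι → F) (w : F) (cc : ι → ι → F),
    (∀ i, g i ≠ 0) ∧ (∀ i j, d (cc i j) = 0) ∧ (∀ i j, cc i j = cc j i) ∧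
    v = (∑ i, r i * (d (g i) / g i)) + d w ∧
    ∀ i, g i ≠ 1 → ∃ c, d c = 0 ∧
      d (r i) = c * (d (1 - g i) / (1 - g i)) + ∑ j, cc i j * (d (g j) / g j)

lemma RRep.rep {d : Der F} {v : F} (h : RRep d v) : Rep d v := by
  classical
  obtain ⟨ι, _, r, g, w, cc, hg, hcc, hsym, hv, hr⟩ := h
  choose! c hc hr using hr
  let e := (Fintype.equivFin ι).symm
  have hm1 : d (-1) = 0 := by rw [map_neg, der_one, neg_zero]
  have h2 : d (1 - -1) = 0 := by rw [map_sub, hm1, der_one, sub_zero]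
  have hgg : ∀ j, d (if g j = 1 then -1 else g j) / (if g j = 1 then -1 else g j)
      = d (g j) / g j := by
    intro j
    split_ifs with h
    · rw [h, hm1, der_one]; simp
    · rfl
  refine ⟨Fintype.card ι, fun i => if g (e i) = 1 then 0 else r (e i),
    fun i => if g (e i) = 1 then -1 else g (e i), w,
    fun i => if g (e i) = 1 then 0 else c (e i),
    fun i j => if g (e i) = 1 ∨ g (e j) = 1 then 0 else cc (e i) (e j), ?_, ?_, ?_, ?_, ?_, ?_⟩
  · intro i
    by_cases h : g (e i) = 1
    · simp only [h, if_true]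
      refine ⟨by norm_num, ?_⟩
      intro hh
      have : (2 : F) = 0 := by linear_combination -hh
      norm_num at this
    · simp only [h, if_false]
      exact ⟨hg _, h⟩
  · intro i
    by_cases h : g (e i) = 1
    · simp [h]
    · simp only [h, if_false]; exact hc _ h
  · intro i j
    dsimp only
    split_ifs
    · simp
    · exact hcc _ _
  · intro i j
    dsimp only
    rw [hsym (e i) (e j)]
    simp only [or_comm]
  · rw [hv]
    congr 1
    rw [← e.sum_comp]
    apply Finset.sum_congr rfl
    intro i _
    dsimp only
    rw [hgg]
    split_ifs with h
    · rw [h, der_one]; simp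
    · rfl
  · intro i
    by_cases h : g (e i) = 1
    · simp [h]
    · simp only [h, if_false, false_or]
      rw [hr _ h]
      congr 1
      rw [← e.sum_comp]
      apply Finset.sum_congr rfl
      intro j _
      rw [hgg]
      split_ifs with h
      · rw [h, der_one]; simp
      · rfl

lemma RRep.add {d : Der F} {v v' : F} (h : RRep d v) (h' : RRep d v') : RRep d (v + v') := by
  obtain ⟨ι, _, r, g, w, cc, hg, hcc, hsym, hv, hr⟩ := h
  obtain ⟨κ, _, r', g', w', cc', hg', hcc', hsym', hv', hr'⟩ := h'
  refine ⟨ι ⊕ κ, inferInstance, Sum.elim r r', Sum.elim g g', w + w',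
    Sum.elim (fun i => Sum.elim (cc i) (fun _ => 0)) (fun i => Sum.elim (fun _ => 0) (cc' i)),
    ?_, ?_, ?_, ?_, ?_⟩
  · rintro (i | i) <;> simp [hg, hg']
  · rintro (i | i) (j | j) <;> simp [hcc, hcc']
  · rintro (i | i) (j | j)
    · exact hsym i j
    · rfl
    · rfl
    · exact hsym' i j
  · rw [hv, hv']; simp only [Fintype.sum_sum_type, Sum.elim_inl, Sum.elim_inr, map_add]; ring
  · rintro (i | i) hi
    · simpa using hr i hi
    · simpa using hr' i hi

lemma Rep.map {K : Type u} [Field K] [CharZero K] {d : Der F} {D : Der K} (k : F →+* K)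
    (hk : ∀ x, D (k x) = k (d x)) {v : F} (h : Rep d v) : Rep D (k v) := by
  obtain ⟨n, r, g, w, c, cc, hg, hc, hcc, hsym, hv, hr⟩ := h
  refine ⟨n, fun i => k (r i), fun i => k (g i), k w, fun i => k (c i), fun i j => k (cc i j),
    ?_, ?_, ?_, ?_, ?_, ?_⟩
  · intro i
    refine ⟨(map_ne_zero k).2 (hg i).1, fun h => (hg i).2 (k.injective (h.trans (map_one k).symm))⟩
  · intro i; rw [hk, hc, map_zero]
  · intro i j; rw [hk, hcc, map_zero]
  · intro i j; dsimp only; rw [hsym]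
  · rw [hv, map_add, map_sum, hk]
    simp only [map_mul, map_div₀, hk]
  · intro i
    have : (1 : K) - k (g i) = k (1 - g i) := by simp
    dsimp only
    rw [this]
    simp only [hk, hr]
    simp only [map_add, map_mul, map_div₀, map_sum]

lemma absorb (d : Der F) (a a1 c : F) (n n1 : ℤ) (hc : d c = 0)
    (hpair : (a = 1 ∧ n = 0) ∨ (a1 = -a ∧ n1 = n) ∨ (a1 = 1 ∧ n1 = 0) ∨
      (a ≠ 1 ∧ a1 = 1 - a ∧ n = 0 ∧ n1 = 0)) :
    (∃ e c', d e = 0 ∧ d c' = 0 ∧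
      (a ≠ 1 → c * (d a1 / a1) = e * (d a / a) + c' * (d (1 - a) / (1 - a)))) ∧
    (n : F) * (c * (d a1 / a1)) = c * n1 * (d a / a) := by
  rcases hpair with ⟨h1, h2⟩ | ⟨h1, h2⟩ | ⟨h1, h2⟩ | ⟨h1, h2, h3, h4⟩
  · subst h1 h2
    exact ⟨⟨0, 0, by simp, by simp, fun h => absurd rfl h⟩, by rw [der_one]; simp⟩
  · subst h1 h2
    refine ⟨⟨c, 0, hc, by simp, fun _ => ?_⟩, ?_⟩
    · rw [map_neg, neg_div_neg_eq]; ring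
    · rw [map_neg, neg_div_neg_eq]; ring
  · subst h1 h2
    refine ⟨⟨0, 0, by simp, by simp, fun _ => ?_⟩, ?_⟩
    · rw [der_one]; simp
    · rw [der_one]; simp
  · subst h2 h3 h4
    exact ⟨⟨0, c, by simp, hc, fun _ => by ring⟩, by simp⟩

lemma exp_alg (d : Der F) {ι : Type} [Fintype ι] (α v w0 : F) (r a a1 : ι → F) (n n1 : ι → ℤ)
    (c : ι → F) (cc : ι → ι → F) (ha : ∀ i, a i ≠ 0)
    (hc : ∀ i, d (c i) = 0) (hcc : ∀ i j, d (cc i j) = 0) (hsym : ∀ i j, cc i j = cc j i)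
    (hpair : ∀ i, (a i = 1 ∧ n i = 0) ∨ (a1 i = -a i ∧ n1 i = n i) ∨ (a1 i = 1 ∧ n1 i = 0) ∨
      (a i ≠ 1 ∧ a1 i = 1 - a i ∧ n i = 0 ∧ n1 i = 0))
    (hr : ∀ i, d (r i) = c i * (d (a1 i) / a1 i - n1 i * d α)
      + ∑ j, cc i j * (d (a j) / a j - n j * d α))
    (hv : v = ∑ i, r i * (d (a i) / a i - n i * d α) + d w0) : RRep d v := by
  classical
  have hA := fun i => absorb d (a i) (a1 i) (c i) (n i) (n1 i) (hc i) (hpair i)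
  choose e c' he hc' hec using fun i => (hA i).1
  have hn := fun i => (hA i).2
  clear hA
  set κ : ι → F := fun i => c i * n1 i + ∑ j, cc i j * n j with hκ
  have hdκ : ∀ i, d (κ i) = 0 := by
    intro i
    simp only [hκ, map_add, map_sum, der_mul, der_int, hc, hcc]
    simp
  set M : F := ∑ i, n i * κ i with hM
  have hdM : d M = 0 := by
    simp only [hM, map_sum, der_mul, der_int, hdκ]; simp
  have hd2 : d (2⁻¹ : F) = 0 := by
    rw [der_inv, show (2 : F) = ((2 : ℤ) : F) by norm_num, der_int]; simp
  have hr' : ∀ i, d (r i) = c i * (d (a1 i) / a1 i) + ∑ j, cc i j * (d (a j) / a j) - κ i * d α := by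
    intro i
    rw [hr i]
    simp only [hκ, mul_sub, Finset.sum_sub_distrib, add_mul, Finset.sum_mul, mul_assoc]
    ring
  refine ⟨ι, inferInstance, fun i => r i + α * κ i, a,
    w0 - α * (∑ i, n i * r i) - 2⁻¹ * M * (α * α), fun i j => cc i j + if i = j then e i else 0,
    ha, ?_, ?_, ?_, ?_⟩
  · intro i j
    rw [map_add, hcc]
    split_ifs <;> simp [he]
  · intro i j
    dsimp only
    rw [hsym i j]
    by_cases h : i = j
    · subst h; rfl
    · rw [if_neg h, if_neg (Ne.symm h)]
  · have key : ∑ i, (n i : F) * d (r i) = ∑ i, κ i * (d (a i) / a i) - M * d α := by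
      simp only [hr', mul_sub, mul_add, Finset.sum_sub_distrib, Finset.sum_add_distrib, hn, hM, hκ,
        add_mul, Finset.sum_mul, Finset.mul_sum]
      rw [Finset.sum_comm]
      simp only [← mul_assoc]
      congr 2
      apply Finset.sum_congr rfl
      intro i _
      apply Finset.sum_congr rfl
      intro j _
      rw [hsym i j]; ring
    have hS : d (∑ i, (n i : F) * r i) = ∑ i, (n i : F) * d (r i) := by
      simp only [map_sum, der_const_mul d (der_int d _)]
    rw [map_sub, map_sub, der_mul d α, hS, key, mul_assoc, der_const_mul d hd2,
      der_const_mul d hdM, der_mul d α α, hv]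
    have e1 : ∑ i, r i * (d (a i) / a i - n i * d α) = ∑ i, r i * (d (a i) / a i)
        - (∑ i, (n i : F) * r i) * d α := by
      simp only [mul_sub, Finset.sum_sub_distrib, Finset.sum_mul]
      congr 1
      apply Finset.sum_congr rfl; intro i _; ring
    have e2 : ∑ i, (r i + α * κ i) * (d (a i) / a i) = ∑ i, r i * (d (a i) / a i)
        + α * ∑ i, κ i * (d (a i) / a i) := by
      simp only [add_mul, Finset.sum_add_distrib, Finset.mul_sum, mul_assoc]
    rw [e1, e2]
    field_simp
    ring
  · intro i hi
    refine ⟨c' i, hc' i, ?_⟩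
    rw [map_add, der_mul, hdκ, hr', hec i hi]
    simp only [add_mul, Finset.sum_add_distrib, ite_mul, zero_mul, Finset.sum_ite_eq,
      Finset.mem_univ, if_true]
    ring

lemma prim_alg (d : Der F) {ι : Type} [Fintype ι] (b v w0 q f : F) (s dd l a a1 : ι → F)
    (n n1 : ι → ℤ)
    (c : ι → F) (cc : ι → ι → F) (ha : ∀ i, a i ≠ 0) (ha1 : ∀ i, a1 i ≠ 0)
    (hc : ∀ i, d (c i) = 0) (hcc : ∀ i j, d (cc i j) = 0) (hsym : ∀ i j, cc i j = cc j i)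
    (hpair : ∀ i, (a i = 1 ∧ n i = 0) ∨ (a1 i = -a i ∧ n1 i = n i) ∨ (a1 i = 1 ∧ n1 i = 0) ∨
      (a i ≠ 1 ∧ a1 i = 1 - a i ∧ n i = 0 ∧ n1 i = 0))
    (hdd : ∀ i, d (dd i) = 0) (hf : d f = 0)
    (hr : ∀ i, d (s i) + dd i * b = c i * (d (a1 i) / a1 i) + ∑ j, cc i j * (d (a j) / a j))
    (hq : d q + 2 * f * b + ∑ i, dd i * (d (a i) / a i) = 0)
    (hv : v = ∑ i, (dd i * (d (l i) - n i * b) + s i * (d (a i) / a i)) + d w0 + b * q)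
    (hb : ∀ y, d y ≠ b)
    (hdil : (∃ (κ : Type) (_ : Fintype κ) (σ : F) (γ h : κ → F), (∀ k, h k ≠ 0) ∧
        (∀ k, d (γ k) = 0) ∧ b = d σ + ∑ k, γ k * (d (h k) / h k)) ∨
      ∀ q, d q = 0 → RRep d (b * q)) : RRep d v := by
  classical
  have hA := fun i => absorb d (a i) (a1 i) (c i) (n i) (n1 i) (hc i) (hpair i)
  choose e c' he hc' hec using fun i => (hA i).1
  clear hA
  have hd2 : d (2 : F) = 0 := by
    rw [show (2 : F) = ((2 : ℤ) : F) by norm_num, der_int]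
  have hcc' : ∀ i j, d (cc i j + if i = j then e i else 0) = 0 := by
    intro i j
    rw [map_add, hcc]
    split_ifs <;> simp [he]
  have hsym' : ∀ i j, (cc i j + if i = j then e i else 0) = (cc j i + if j = i then e j else 0) := by
    intro i j
    rw [hsym i j]
    by_cases h : i = j
    · subst h; rfl
    · rw [if_neg h, if_neg (Ne.symm h)]
  by_cases hlog : ∃ (κ : Type) (_ : Fintype κ) (σ : F) (γ h : κ → F), (∀ k, h k ≠ 0) ∧
        (∀ k, d (γ k) = 0) ∧ b = d σ + ∑ k, γ k * (d (h k) / h k)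
  · obtain ⟨κ, _, σ, γ, h, hh, hγ, hbσ⟩ := hlog
    set Λ := ∑ k, γ k * (d (h k) / h k) with hΛ
    set N : F := -∑ i, (n i : F) * dd i with hN
    have hdN : d N = 0 := by
      simp only [hN, map_neg, map_sum, der_const_mul d (der_int d _), hdd]; simp
    have hd2f : d (2 * f) = 0 := by rw [der_mul, hd2, hf]; simp
    refine ⟨ι ⊕ κ, inferInstance, Sum.elim (fun i => s i + dd i * σ)
      (fun k => γ k * (q + 2 * f * σ + N)), Sum.elim a h,
      w0 + ∑ i, dd i * l i + σ * (q + 2 * f * σ) + N * σ - f * (σ * σ),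
      Sum.elim (fun i => Sum.elim (fun j => cc i j + if i = j then e i else 0)
        (fun k => -(dd i * γ k))) (fun k => Sum.elim (fun i => -(dd i * γ k))
        (fun m => -(2 * f) * (γ k * γ m))), ?_, ?_, ?_, ?_, ?_⟩
    · rintro (i | i) <;> simp [ha, hh]
    · rintro (i | i) (j | j)
      · exact hcc' i j
      · simp [hdd, hγ]
      · simp [hdd, hγ]
      · simp [hf, hγ, hd2, der_mul]
    · rintro (i | i) (j | j)
      · exact hsym' i j
      · rfl
      · rfl
      · simp only [Sum.elim_inr]; ring
    · simp only [Fintype.sum_sum_type, Sum.elim_inl, Sum.elim_inr]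
      have e1 : ∑ k, γ k * (q + 2 * f * σ + N) * (d (h k) / h k) = (q + 2 * f * σ + N) * Λ := by
        rw [hΛ, Finset.mul_sum]
        apply Finset.sum_congr rfl; intro k _; ring
      have e2 : ∑ i, (s i + dd i * σ) * (d (a i) / a i) = ∑ i, s i * (d (a i) / a i)
          + σ * ∑ i, dd i * (d (a i) / a i) := by
        rw [Finset.mul_sum, ← Finset.sum_add_distrib]
        apply Finset.sum_congr rfl; intro k _; ring
      have e3 : ∑ i, (dd i * (d (l i) - n i * b) + s i * (d (a i) / a i)) =
          ∑ i, dd i * d (l i) + N * b + ∑ i, s i * (d (a i) / a i) := by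
        rw [hN, neg_mul, Finset.sum_mul, ← Finset.sum_neg_distrib, ← Finset.sum_add_distrib,
          ← Finset.sum_add_distrib]
        apply Finset.sum_congr rfl; intro k _; ring
      have e4 : d (∑ i, dd i * l i) = ∑ i, dd i * d (l i) := by
        rw [map_sum]
        apply Finset.sum_congr rfl; intro k _; rw [der_const_mul d (hdd k)]
      rw [hv, e1, e2, e3]
      simp only [map_add, map_sub]
      rw [e4, der_mul d σ, map_add, der_const_mul d hd2f, der_const_mul d hdN,
        der_const_mul d hf, der_mul d σ σ, hbσ]
      rw [hbσ] at hq
      linear_combination -σ * hq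
    · rintro (i | i) hi
      · refine ⟨c' i, hc' i, ?_⟩
        have hi' : a i ≠ 1 := hi
        simp only [Fintype.sum_sum_type, Sum.elim_inl, Sum.elim_inr]
        rw [map_add, der_const_mul d (hdd i)]
        have h1 := hr i
        rw [hec i hi'] at h1
        have e1 : ∑ k, -(dd i * γ k) * (d (h k) / h k) = -(dd i * Λ) := by
          rw [hΛ, Finset.mul_sum, ← Finset.sum_neg_distrib]
          apply Finset.sum_congr rfl; intro k _; ring
        simp only [add_mul, Finset.sum_add_distrib, ite_mul, zero_mul, Finset.sum_ite_eq,
          Finset.mem_univ, if_true]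
        rw [e1]
        linear_combination h1 - dd i * hbσ
      · refine ⟨0, by simp, ?_⟩
        simp only [Fintype.sum_sum_type, Sum.elim_inl, Sum.elim_inr]
        rw [der_const_mul d (hγ i), map_add, map_add, hdN, der_const_mul d hd2f]
        have e1 : ∑ k, -(2 * f) * (γ i * γ k) * (d (h k) / h k) = -(2 * f) * γ i * Λ := by
          rw [hΛ, Finset.mul_sum]
          apply Finset.sum_congr rfl; intro k _; ring
        have e2 : ∑ k, -(dd k * γ i) * (d (a k) / a k) = -γ i * ∑ k, dd k * (d (a k) / a k) := by
          rw [Finset.mul_sum]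
          apply Finset.sum_congr rfl; intro k _; ring
        rw [e1, e2]
        linear_combination γ i * hq - 2 * f * γ i * hbσ
  · have hRR := hdil.resolve_left hlog
    have hdd0 : ∀ i, dd i = 0 := by
      intro i
      by_contra hne
      apply hlog
      have hdi : d (dd i)⁻¹ = 0 := by rw [der_inv, hdd]; simp
      refine ⟨Option ι, inferInstance, -((dd i)⁻¹ * s i),
        fun o => (dd i)⁻¹ * o.elim (c i) (cc i), fun o => o.elim (a1 i) a, ?_, ?_, ?_⟩
      · rintro (_ | j)
        · exact ha1 i
        · exact ha j
      · rintro (_ | j)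
        · simp only [Option.elim]; rw [der_const_mul d hdi, hc, mul_zero]
        · simp only [Option.elim]; rw [der_const_mul d hdi, hcc, mul_zero]
      · rw [map_neg, der_const_mul d hdi, Fintype.sum_option]
        simp only [Option.elim]
        have h1 := hr i
        have e1 : ∑ j, (dd i)⁻¹ * cc i j * (d (a j) / a j)
            = (dd i)⁻¹ * ∑ j, cc i j * (d (a j) / a j) := by
          rw [Finset.mul_sum]
          apply Finset.sum_congr rfl; intro k _; ring
        rw [e1]
        have h2 : b = (dd i)⁻¹ * (dd i * b) := by field_simp
        rw [h2]
        linear_combination (dd i)⁻¹ * h1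
    simp only [hdd0, zero_mul, Finset.sum_const_zero, add_zero, zero_add] at hq hr hv
    have hf0 : f = 0 := by
      by_contra hne
      apply hb (-(2 * f)⁻¹ * q)
      have hd2f : d (-(2 * f)⁻¹) = 0 := by rw [map_neg, der_inv, der_mul, hd2, hf]; simp
      rw [der_const_mul d hd2f]
      field_simp
      linear_combination -hq
    rw [hf0] at hq
    have hq0 : d q = 0 := by linear_combination hq
    rw [hv]
    refine RRep.add ⟨ι, inferInstance, s, a, w0, fun i j => cc i j + if i = j then e i else 0, ha,
      hcc', hsym', rfl, ?_⟩ (hRR q hq0)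
    intro i hi
    refine ⟨c' i, hc' i, ?_⟩
    rw [hr, hec i hi]
    simp only [add_mul, Finset.sum_add_distrib, ite_mul, zero_mul, Finset.sum_ite_eq,
      Finset.mem_univ, if_true]
    ring

end rep
end Dilog

namespace Dilog
section step
variable {F : Type u} [Field F] [CharZero F]

lemma coeff_C_mul' (a : F) (x : HahnSeries ℤ F) (n : ℤ) :
    (HahnSeries.C a * x).coeff n = a * x.coeff n := by
  rw [HahnSeries.C_apply, HahnSeries.coeff_single_zero_mul]

lemma coeff_const_mul (c : HahnSeries ℤ F) (hc : c = HahnSeries.C (c.coeff 0))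
    (x : HahnSeries ℤ F) (n : ℤ) : (c * x).coeff n = c.coeff 0 * x.coeff n := by
  conv_lhs => rw [hc]
  exact coeff_C_mul' _ _ _

lemma coeff_fsum {ι : Type} [Fintype ι] (f : ι → HahnSeries ℤ F) (n : ℤ) :
    (∑ i, f i).coeff n = ∑ i, (f i).coeff n := by
  exact map_sum (⟨⟨fun x : HahnSeries ℤ F => x.coeff n, by simp⟩, by simp⟩ :
    HahnSeries ℤ F →+ F) _ _

lemma exp_step (d : Der F) (α : F)
    (hb : ∀ (m : ℤ) (y : F), m ≠ 0 → d y = m * d α * y → y = 0) (v : F)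
    (h : Rep (lder d 0 (d α)) (HahnSeries.C v)) : RRep d v := by
  obtain ⟨k, r, g, w, c, cc, hg, hc, hcc, hsym, hv, hr⟩ := h
  have hC := fun i => exp_const d _ hb (c i) (hc i)
  have hCC := fun i j => exp_const d _ hb (cc i j) (hcc i j)
  have hg1 : ∀ i, 1 - g i ≠ 0 := fun i => sub_ne_zero.2 (hg i).2.symm
  have hrn : ∀ i n, (lder d 0 (d α) (r i)).coeff n =
      (c i).coeff 0 * (lder d 0 (d α) (1 - g i) / (1 - g i)).coeff n +
        ∑ j, (cc i j).coeff 0 * (lder d 0 (d α) (g j) / g j).coeff n := by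
    intro i n
    have := hr i
    rw [this, HahnSeries.coeff_add, coeff_const_mul _ (hC i).2, coeff_fsum]
    congr 1
    exact Finset.sum_congr rfl (fun j _ => coeff_const_mul _ (hCC i j).2 _ _)
  have hneg := fun i => dlog_nonneg d 0 le_rfl (d α) (g i) (hg i).1
  have hneg1 := fun i => dlog_nonneg d 0 le_rfl (d α) (1 - g i) (hg1 i)
  have hr0 : ∀ i, ∀ n < 0, (r i).coeff n = 0 := by
    intro i n hn
    apply exp_bound d (d α) hb (r i) n hn.ne
    rw [hrn, hneg1 i n hn]
    simp [hneg _ n hn]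
  have hv0 := congrArg (fun x => x.coeff 0) hv
  simp only [HahnSeries.coeff_add, coeff_fsum] at hv0
  refine exp_alg d α v (w.coeff 0) (fun i => (r i).coeff 0) (fun i => (g i).coeff (g i).order)
    (fun i => (1 - g i).coeff (1 - g i).order) (fun i => (g i).order) (fun i => (1 - g i).order)
    (fun i => (c i).coeff 0) (fun i j => (cc i j).coeff 0)
    (fun i => HahnSeries.coeff_order_eq_zero.not.2 (hg i).1) (fun i => (hC i).1)
    (fun i j => (hCC i j).1) (fun i j => by rw [hsym]) (fun i => pair_lemma _ (hg i).1) ?_ ?_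
  · intro i
    have := hrn i 0
    rw [lder_coeff, dlog_exp d _ _ (hg1 i)] at this
    simp_rw [fun j => dlog_exp d (d α) (g j) (hg j).1] at this
    rw [← this]; simp
  · have e1 : ∀ i, (r i * (lder d 0 (d α) (g i) / g i)).coeff 0 = (r i).coeff 0 *
        (d ((g i).coeff (g i).order) / (g i).coeff (g i).order - (g i).order * d α) := by
      intro i
      have := (mul_coeffs (r i) (lder d 0 (d α) (g i) / g i) 0 0 (hr0 i) (hneg i)).2.1
      rw [add_zero] at this
      rw [this, dlog_exp d _ _ (hg i).1]
    simp_rw [e1, lder_coeff] at hv0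
    simpa using hv0

lemma prim_step (d : Der F) (b : F) (hb : ∀ y, d y ≠ b)
    (hdil : (∃ (κ : Type) (_ : Fintype κ) (σ : F) (γ h : κ → F), (∀ k, h k ≠ 0) ∧
        (∀ k, d (γ k) = 0) ∧ b = d σ + ∑ k, γ k * (d (h k) / h k)) ∨
      ∀ q, d q = 0 → RRep d (b * q)) (v : F)
    (h : Rep (lder d 1 b) (HahnSeries.C v)) : RRep d v := by
  obtain ⟨k, r, g, w, c, cc, hg, hc, hcc, hsym, hv, hr⟩ := h
  have hC := fun i => prim_const d _ hb (c i) (hc i)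
  have hCC := fun i j => prim_const d _ hb (cc i j) (hcc i j)
  have hg1 : ∀ i, 1 - g i ≠ 0 := fun i => sub_ne_zero.2 (hg i).2.symm
  have hrn : ∀ i n, (lder d 1 b (r i)).coeff n =
      (c i).coeff 0 * (lder d 1 b (1 - g i) / (1 - g i)).coeff n +
        ∑ j, (cc i j).coeff 0 * (lder d 1 b (g j) / g j).coeff n := by
    intro i n
    have := hr i
    rw [this, HahnSeries.coeff_add, coeff_const_mul _ (hC i).2, coeff_fsum]
    congr 1
    exact Finset.sum_congr rfl (fun j _ => coeff_const_mul _ (hCC i j).2 _ _)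
  have hneg := fun i => dlog_nonneg d 1 zero_le_one b (g i) (hg i).1
  have hneg1 := fun i => dlog_nonneg d 1 zero_le_one b (1 - g i) (hg1 i)
  have hrneg : ∀ i, ∀ n < 0, (lder d 1 b (r i)).coeff n = 0 := by
    intro i n hn
    rw [hrn, hneg1 i n hn]
    simp [hneg _ n hn]
  have hr0 : ∀ i, ∀ n < -1, (r i).coeff n = 0 := fun i =>
    prim_bound d b hb (r i) 0 le_rfl (hrneg i)
  have hmul := fun i => mul_coeffs (r i) (lder d 1 b (g i) / g i) (-1) 0 (hr0 i) (hneg i)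
  have hvn : ∀ n : ℤ, (HahnSeries.C v : HahnSeries ℤ F).coeff n =
      ∑ i, (r i * (lder d 1 b (g i) / g i)).coeff n + (lder d 1 b w).coeff n := by
    intro n
    have := congrArg (fun x => x.coeff n) hv
    simpa only [HahnSeries.coeff_add, coeff_fsum] using this
  have hvz : ∀ n : ℤ, n ≠ 0 → (HahnSeries.C v : HahnSeries ℤ F).coeff n = 0 := by
    intro n hn
    rw [HahnSeries.C_apply, HahnSeries.coeff_single_of_ne hn]
  have hwneg : ∀ n < -1, (lder d 1 b w).coeff n = 0 := by
    intro n hn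
    have := hvn n
    rw [hvz n (by omega), Finset.sum_eq_zero (fun i _ => (hmul i).1 n (by simpa using hn)),
      zero_add] at this
    exact this.symm
  have hw0 : ∀ n < -2, w.coeff n = 0 := fun n hn =>
    prim_bound d b hb w (-1) (by norm_num) hwneg n (by omega)
  choose l hl using fun i => dlog_prim1 d b (g i) (hg i).1
  refine prim_alg d b v (w.coeff 0) (w.coeff (-1)) (w.coeff (-2)) (fun i => (r i).coeff 0)
    (fun i => (r i).coeff (-1)) l (fun i => (g i).coeff (g i).order)
    (fun i => (1 - g i).coeff (1 - g i).order) (fun i => (g i).order) (fun i => (1 - g i).order)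
    (fun i => (c i).coeff 0) (fun i j => (cc i j).coeff 0)
    (fun i => HahnSeries.coeff_order_eq_zero.not.2 (hg i).1)
    (fun i => HahnSeries.coeff_order_eq_zero.not.2 (hg1 i)) (fun i => (hC i).1)
    (fun i j => (hCC i j).1) (fun i j => by rw [hsym]) (fun i => pair_lemma _ (hg i).1)
    ?_ ?_ ?_ ?_ ?_ hb hdil
  · intro i
    have := hrneg i (-1) (by norm_num)
    rw [lder_coeff, hr0 i (-1 - 1) (by norm_num)] at this
    linear_combination this
  · have := hwneg (-2) (by norm_num)
    rw [lder_coeff, hw0 (-2 - 1) (by norm_num)] at this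
    linear_combination this
  · intro i
    have := hrn i 0
    rw [lder_coeff, dlog_prim0 d _ _ (hg1 i)] at this
    simp_rw [fun j => dlog_prim0 d b (g j) (hg j).1] at this
    rw [← this]
    norm_num
    ring
  · have := hvn (-1)
    rw [hvz _ (by norm_num), lder_coeff] at this
    have e1 : ∀ i, (r i * (lder d 1 b (g i) / g i)).coeff (-1) = (r i).coeff (-1) *
        (d ((g i).coeff (g i).order) / (g i).coeff (g i).order) := by
      intro i
      have h := (hmul i).2.1
      rw [add_zero] at h
      rw [h, dlog_prim0 d _ _ (hg i).1]
    simp_rw [e1] at this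
    norm_num at this
    linear_combination -this
  · have := hvn 0
    rw [lder_coeff] at this
    have e1 : ∀ i, (r i * (lder d 1 b (g i) / g i)).coeff 0 = (r i).coeff (-1) *
        (d (l i) - (g i).order * b) + (r i).coeff 0 *
        (d ((g i).coeff (g i).order) / (g i).coeff (g i).order) := by
      intro i
      have h := (hmul i).2.2
      norm_num at h
      rw [h, dlog_prim0 d _ _ (hg i).1, hl]
    simp_rw [e1] at this
    norm_num at this
    linear_combination this

end step
end Dilog

namespace Dilog
section ratfunc
variable {F : Type u} [Field F] [CharZero F]

instance : CharZero (RatFunc F) :=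
  charZero_of_injective_ringHom (f := (RatFunc.C : F →+* RatFunc F))
    (RatFunc.C : F →+* RatFunc F).injective

lemma trans_inj {E : Type u} [Field E] (φ : F →+* E) (t : E)
    (h : Transcendental (↥φ.fieldRange) t) :
    Function.Injective (Polynomial.eval₂RingHom φ t) := by
  rw [injective_iff_map_eq_zero]
  intro p hp
  rw [transcendental_iff] at h
  have := h (p.map φ.rangeRestrictField) (by
    rw [Polynomial.aeval_def, Polynomial.eval₂_map]
    exact hp)
  exact (Polynomial.map_eq_zero_iff φ.rangeRestrictField.injective).1 this

lemma trans_X {E : Type u} [Field E] (φ : E →+* RatFunc E) (hφ : φ = RatFunc.C) :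
    Transcendental (↥φ.fieldRange) (RatFunc.X : RatFunc E) := by
  subst hφ
  refine Transcendental.ringHom_of_comp_eq (R := E) (A := RatFunc E) (a := RatFunc.X)
    (RatFunc.C : E →+* RatFunc E).rangeRestrictField (RingHom.id (RatFunc E))
    RatFunc.transcendental_X ?_ Function.injective_id ?_
  · rintro ⟨x, y, rfl⟩
    exact ⟨y, rfl⟩
  · ext x; rfl

noncomputable def rf {K : Type u} [Field K] (φ : F →+* K) (s : K)
    (hinj : Function.Injective (Polynomial.eval₂RingHom φ s)) : RatFunc F →+* K :=
  RatFunc.liftRingHom (Polynomial.eval₂RingHom φ s)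
    (nonZeroDivisors_le_comap_nonZeroDivisors_of_injective _ hinj)

lemma rf_C {K : Type u} [Field K] (φ : F →+* K) (s : K) (hinj) (a : F) :
    rf φ s hinj (RatFunc.C a) = φ a := by
  simp [rf, RatFunc.liftRingHom_C]

lemma rf_X {K : Type u} [Field K] (φ : F →+* K) (s : K) (hinj) :
    rf φ s hinj RatFunc.X = s := by
  simp [rf, RatFunc.liftRingHom_X]

lemma rat_closure : Subfield.closure (Set.range (RatFunc.C : F → RatFunc F) ∪ {RatFunc.X}) = ⊤ := by
  rw [eq_top_iff]
  intro f _
  have hp : ∀ p : Polynomial F, algebraMap (Polynomial F) (RatFunc F) p ∈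
      Subfield.closure (Set.range (RatFunc.C : F → RatFunc F) ∪ {RatFunc.X}) := by
    intro p
    induction p using Polynomial.induction_on' with
    | add p q hp hq => rw [map_add]; exact add_mem hp hq
    | monomial n a =>
      rw [← Polynomial.C_mul_X_pow_eq_monomial, map_mul, map_pow, RatFunc.algebraMap_C,
        RatFunc.algebraMap_X]
      have h1 : RatFunc.C a ∈ Subfield.closure
          (Set.range (RatFunc.C : F → RatFunc F) ∪ {RatFunc.X}) :=
        Subfield.subset_closure (Or.inl ⟨a, rfl⟩)
      have h2 : RatFunc.X ∈ Subfield.closure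
          (Set.range (RatFunc.C : F → RatFunc F) ∪ {RatFunc.X}) :=
        Subfield.subset_closure (Or.inr rfl)
      exact mul_mem h1 (pow_mem h2 n)
  rw [← RatFunc.num_div_denom f]
  exact div_mem (hp _) (hp _)

lemma rf_range {K : Type u} [Field K] (φ : F →+* K) (s : K) (hinj) :
    (rf φ s hinj).fieldRange = Subfield.closure ((φ.fieldRange : Set K) ∪ {s}) := by
  rw [RingHom.fieldRange_eq_map, ← rat_closure, RingHom.map_field_closure, Set.image_union,
    Set.image_singleton, rf_X]
  congr 2
  ext x
  simp [rf_C]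

lemma kap_inj : Function.Injective (Polynomial.eval₂RingHom
    (HahnSeries.C : F →+* HahnSeries ℤ F) (HahnSeries.single (-1:ℤ) (1:F))) := by
  rw [injective_iff_map_eq_zero]
  intro p hp
  ext m
  have h1 := congrArg (fun x : HahnSeries ℤ F => x.coeff (-(m:ℤ))) hp
  simp only [Polynomial.coe_eval₂RingHom, Polynomial.eval₂_eq_sum_range, HahnSeries.coeff_zero] at h1
  rw [HahnSeries.coeff_sum] at h1
  rw [Polynomial.coeff_zero, ← h1]
  simp only [HahnSeries.single_pow, one_pow, coeff_C_mul', HahnSeries.coeff_single]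
  rw [Finset.sum_eq_single m]
  · simp
  · intro b _ hb
    rw [if_neg, mul_zero]
    intro h; apply hb
    simp at h; exact_mod_cast h.symm
  · intro h
    rw [Polynomial.coeff_eq_zero_of_natDegree_lt, zero_mul]
    simpa using h

noncomputable def kap : RatFunc F →+* HahnSeries ℤ F :=
  rf HahnSeries.C (HahnSeries.single (-1:ℤ) (1:F)) kap_inj

lemma closure_der {K : Type u} [Field K] [CharZero K] (D : Der K) (S : Set K)
    (h : ∀ x ∈ S, D x ∈ Subfield.closure S) (x : K) (hx : x ∈ Subfield.closure S) :
    D x ∈ Subfield.closure S := by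
  induction hx using Subfield.closure_induction with
  | mem x hx => exact h x hx
  | one => rw [der_one]; exact zero_mem _
  | add x y _ _ h1 h2 => rw [map_add]; exact add_mem h1 h2
  | neg x _ h1 => rw [map_neg]; exact neg_mem h1
  | inv x hx h1 => rw [der_inv]; exact neg_mem (div_mem h1 (pow_mem hx 2))
  | mul x y hx hy h1 h2 => rw [der_mul]; exact add_mem (mul_mem hx h2) (mul_mem hy h1)

lemma pullDer {K L : Type u} [Field K] [CharZero K] [Field L] [CharZero L] (k : L →+* K)
    (D : Der K) (h : ∀ x, ∃ y, k y = D (k x)) : ∃ dL : Der L, ∀ x, k (dL x) = D (k x) := by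
  choose f hf using h
  refine ⟨mkDer f ?_ ?_, fun x => hf x⟩
  · intro x y; apply k.injective; simp [hf]
  · intro x y; apply k.injective; rw [hf, map_mul, der_mul]; simp [hf]

lemma ratDer (d : Der F) (ε : ℤ) (b : F) (τ : RatFunc F)
    (hτ : kap τ = HahnSeries.single (ε - 1) b) :
    ∃ dR : Der (RatFunc F), (∀ f, lder d ε b (kap f) = kap (dR f)) ∧
      (∀ a, dR (RatFunc.C a) = RatFunc.C (d a)) ∧ dR RatFunc.X = τ := by
  have hX : lder d ε b (kap RatFunc.X) = kap τ := by
    rw [hτ, kap, rf_X, lder_t]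
  have hC : ∀ a, lder d ε b (kap (RatFunc.C a)) = kap (RatFunc.C (d a)) := by
    intro a
    rw [kap, rf_C, rf_C, lder_C]
  have hr := rf_range HahnSeries.C (HahnSeries.single (-1:ℤ) (1:F)) kap_inj
  obtain ⟨dR, hdR⟩ := pullDer (kap (F := F)) (lder d ε b) (by
    intro x
    have : kap x ∈ (kap (F := F)).fieldRange := ⟨x, rfl⟩
    change lder d ε b (kap x) ∈ (kap (F := F)).fieldRange
    unfold kap at this ⊢
    rw [hr] at this ⊢
    refine closure_der _ _ ?_ _ this
    rintro y (⟨a, rfl⟩ | rfl)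
    · rw [lder_C]
      exact Subfield.subset_closure (Or.inl ⟨d a, rfl⟩)
    · rw [← hr]
      refine ⟨τ, ?_⟩
      have := hX.symm
      rwa [kap, rf_X] at this)
  refine ⟨dR, fun f => (hdR f).symm, fun a => ?_, ?_⟩
  · apply (kap (F := F)).injective; rw [hdR, hC]
  · apply (kap (F := F)).injective; rw [hdR, hX]

lemma ratDer_prim (d : Der F) (b : F) :
    ∃ dR : Der (RatFunc F), (∀ f, lder d 1 b (kap f) = kap (dR f)) ∧
      (∀ a, dR (RatFunc.C a) = RatFunc.C (d a)) ∧ dR RatFunc.X = RatFunc.C b := by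
  apply ratDer
  rw [kap, rf_C, HahnSeries.C_apply, sub_self]

lemma ratDer_exp (d : Der F) (b : F) :
    ∃ dR : Der (RatFunc F), (∀ f, lder d 0 b (kap f) = kap (dR f)) ∧
      (∀ a, dR (RatFunc.C a) = RatFunc.C (d a)) ∧ dR RatFunc.X = RatFunc.C b * RatFunc.X := by
  apply ratDer
  rw [kap, map_mul, rf_C, rf_X, HahnSeries.C_apply, HahnSeries.single_mul_single]
  simp

lemma commute {E : Type u} [Field E] [CharZero E] (d : Der F) (dR : Der (RatFunc F)) (δ : Der E)
    (j : RatFunc F →+* E) (hC : ∀ a, dR (RatFunc.C a) = RatFunc.C (d a))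
    (hjC : ∀ a, δ (j (RatFunc.C a)) = j (RatFunc.C (d a)))
    (hjX : δ (j RatFunc.X) = j (dR RatFunc.X)) (f : RatFunc F) : δ (j f) = j (dR f) := by
  have hf : f ∈ Subfield.closure (Set.range (RatFunc.C : F → RatFunc F) ∪ {RatFunc.X}) := by
    rw [rat_closure]; trivial
  induction hf using Subfield.closure_induction with
  | mem x hx =>
    rcases hx with ⟨a, rfl⟩ | rfl
    · rw [hjC, hC]
    · exact hjX
  | one => rw [map_one, der_one, der_one, map_zero]
  | add x y _ _ h1 h2 => simp [h1, h2]
  | neg x _ h1 => simp [h1]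
  | inv x hx h1 => rw [der_inv, map_inv₀, der_inv, h1]; simp
  | mul x y hx hy h1 h2 => rw [map_mul, der_mul, der_mul, h1, h2]; simp

end ratfunc
end Dilog

namespace Dilog
section forward

lemma RRep.exact {F : Type u} [Field F] [CharZero F] (d : Der F) (w : F) : RRep d (d w) :=
  ⟨Empty, inferInstance, Empty.elim, Empty.elim, w, fun i => i.elim, fun i => i.elim,
    fun i => i.elim, fun i => i.elim, by simp, fun i => i.elim⟩

lemma closure_aux {E : Type u} [Field E] (A : Set E) (s : E) (B : Set E) :
    Subfield.closure ((Subfield.closure (A ∪ {s}) : Set E) ∪ B)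
      = Subfield.closure (A ∪ ({s} ∪ B)) := by
  rw [Subfield.closure_union, Subfield.closure_eq, ← Subfield.closure_union, Set.union_assoc]

lemma tower_tail {E : Type u} [Field E] [CharZero E] (δ : Der E) (B B' : Subfield E) {n : ℕ}
    (θ : Fin (n+1) → E) (h : IsTransDilogElemTower δ B θ)
    (hB : B' = Subfield.closure ((B : Set E) ∪ {θ 0})) :
    IsTransDilogElemTower δ B' (fun i : Fin n => θ i.succ) := by
  subst hB
  refine ⟨fun i => ?_, ?_⟩
  · have := h.1 i.succ
    have hs : θ '' {j | j < i.succ} = {θ 0} ∪ (fun i : Fin n => θ i.succ) '' {j | j < i} := by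
      ext x
      constructor
      · rintro ⟨k, hk, rfl⟩
        induction k using Fin.cases with
        | zero => exact Or.inl rfl
        | succ k => exact Or.inr ⟨k, Fin.succ_lt_succ_iff.1 hk, rfl⟩
      · rintro (rfl | ⟨k, hk, rfl⟩)
        · exact ⟨0, Fin.succ_pos i, rfl⟩
        · exact ⟨k.succ, Fin.succ_lt_succ_iff.2 hk, rfl⟩
    rw [closure_aux, ← hs]
    exact this
  · have hs : Set.range θ = {θ 0} ∪ Set.range (fun i : Fin n => θ i.succ) := by
      ext x
      constructor
      · rintro ⟨k, rfl⟩
        induction k using Fin.cases with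
        | zero => exact Or.inl rfl
        | succ k => exact Or.inr ⟨k, rfl⟩
      · rintro (rfl | ⟨k, rfl⟩)
        · exact ⟨0, rfl⟩
        · exact ⟨k.succ, rfl⟩
    rw [closure_aux, ← hs]
    exact h.2

lemma der_zpow {K : Type u} [Field K] [CharZero K] (D : Der K) (t b : K) (ht : t ≠ 0)
    (h : D t = b * t) (m : ℤ) : D (t ^ m) = m * b * t ^ m := by
  induction m using Int.induction_on with
  | zero => simp
  | succ n ih =>
    rw [zpow_add_one₀ ht, der_mul, ih, h]; push_cast; ring
  | pred n ih =>
    rw [zpow_sub_one₀ ht, der_mul, ih, der_inv, h]; push_cast; field_simp; ring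

theorem forward {E : Type u} [Field E] [CharZero E] (δ : Der E) (u : E) (n : ℕ) :
    ∀ (F : Type u) [Field F] [CharZero F] (d : Der F) (ι : F →+* E)
      (_ : ∀ x, δ (ι x) = ι (d x)) (_ : ∀ y, δ y = 0 → ∃ x, d x = 0 ∧ ι x = y)
      (θ : Fin n → E) (_ : IsTransDilogElemTower δ ι.fieldRange θ) (v : F) (_ : δ u = ι v),
      Rep d v := by
  induction n with
  | zero =>
    intro F _ _ d ι hc hk θ ht v hv
    have h2 := ht.2
    rw [Set.range_eq_empty, Set.union_empty, Subfield.closure_eq] at h2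
    have : u ∈ ι.fieldRange := by rw [h2]; trivial
    obtain ⟨u0, rfl⟩ := this
    rw [hc] at hv
    rw [← ι.injective hv]
    exact (RRep.exact d u0).rep
  | succ n ih =>
    intro F _ _ d ι hc hk θ ht v hv
    have h0 := ht.1 0
    have hs : {j : Fin (n+1) | j < 0} = ∅ := by
      ext x; simp
    rw [hs, Set.image_empty, Set.union_empty, Subfield.closure_eq] at h0
    obtain ⟨htr, hgen⟩ := h0
    have hinj := trans_inj ι _ htr
    have hnr : ∀ (m : ℕ) (a : F), 0 < m → θ 0 ^ m ≠ ι a := by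
      intro m a hm he
      have := @hinj (Polynomial.X ^ m) (Polynomial.C a) (by simpa using he)
      have h2 := congrArg Polynomial.natDegree this
      rw [Polynomial.natDegree_X_pow, Polynomial.natDegree_C] at h2
      omega
    have ht0 : θ 0 ≠ 0 := by
      intro h; apply hnr 1 0 one_pos; simp [h]
    have key : ∀ dR : Der (RatFunc F), (∀ a, dR (RatFunc.C a) = RatFunc.C (d a)) →
        δ (θ 0) = rf ι (θ 0) hinj (dR RatFunc.X) → Rep dR (RatFunc.C v) := by
      intro dR hC hX
      have hcom := commute d dR δ (rf ι (θ 0) hinj) hC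
        (fun a => by rw [rf_C, rf_C, hc]) (by rw [rf_X, hX])
      refine ih (RatFunc F) dR (rf ι (θ 0) hinj) hcom ?_
        (fun i => θ i.succ) (tower_tail δ _ _ θ ht (rf_range ι (θ 0) hinj)) _ ?_
      · intro y hy
        obtain ⟨x, hx, rfl⟩ := hk y hy
        exact ⟨RatFunc.C x, by rw [hC, hx, map_zero], rf_C _ _ _ _⟩
      · rw [rf_C, hv]
    have hprim : ∀ b : F, δ (θ 0) = ι b → ∀ y, d y ≠ b := by
      intro b hb y hy
      obtain ⟨x, hx, hx2⟩ := hk (θ 0 - ι y) (by rw [map_sub, hb, hc, hy, sub_self])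
      apply hnr 1 (x + y) one_pos
      rw [map_add, hx2]; ring
    have hP : ∀ b : F, δ (θ 0) = ι b → Rep (lder d 1 b) (HahnSeries.C v) := by
      intro b hb
      obtain ⟨dR, h1, h2, h3⟩ := ratDer_prim d b
      have := Rep.map (D := lder d 1 b) kap h1 (key dR h2 (by rw [h3, rf_C, hb]))
      rwa [kap, rf_C] at this
    rcases hgen with ⟨a, ⟨α, rfl⟩, h⟩ | ⟨a, ⟨α, rfl⟩, hα, h⟩ | ⟨g, ⟨g, rfl⟩, hg0, hg1, η, ⟨η, rfl⟩, hη, h⟩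
    · rw [hc] at h
      obtain ⟨dR, h1, h2, h3⟩ := ratDer_exp d (d α)
      have := Rep.map (D := lder d 0 (d α)) kap h1
        (key dR h2 (by rw [h3, map_mul, rf_C, rf_X, h]))
      rw [kap, rf_C] at this
      refine (exp_step d α ?_ v this).rep
      intro m y hm hy
      by_contra hy0
      have hιy : ι y ≠ 0 := (map_ne_zero ι).2 hy0
      obtain ⟨x, hx, hx2⟩ := hk (ι y * (θ 0) ^ (-m)) (by
        rw [der_mul, der_zpow δ _ _ ht0 h, hc, hy, map_mul, map_mul, map_intCast]
        push_cast; ring)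
      have hx0 : x ≠ 0 := by
        rintro rfl
        rw [map_zero] at hx2
        exact (mul_ne_zero hιy (zpow_ne_zero _ ht0)) hx2.symm
      have hιx : ι x ≠ 0 := (map_ne_zero ι).2 hx0
      have e1 : θ 0 ^ (-m) = ι (x / y) := by
        rw [map_div₀, hx2]; field_simp
      have e2 : θ 0 ^ m = ι (y / x) := by
        rw [← neg_neg m, zpow_neg, e1, ← map_inv₀, inv_div]
      rcases lt_or_gt_of_ne hm with hneg | hpos
      · obtain ⟨k, hk⟩ := Int.eq_ofNat_of_zero_le (by omega : 0 ≤ -m)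
        rw [hk, zpow_natCast] at e1
        exact hnr k _ (by omega) e1
      · obtain ⟨k, rfl⟩ := Int.eq_ofNat_of_zero_le hpos.le
        rw [zpow_natCast] at e2
        exact hnr k _ (by omega) e2
    · rw [hc, ← map_div₀] at h
      have hα0 : α ≠ 0 := (map_ne_zero ι).1 hα
      refine (prim_step d _ (hprim _ h) (Or.inl ?_) v (hP _ h)).rep
      exact ⟨Unit, inferInstance, 0, fun _ => 1, fun _ => α, fun _ => hα0,
        fun _ => der_one d, by simp⟩
    · rw [hc, ← map_div₀, ← map_mul] at h
      have hg0' : g ≠ 0 := (map_ne_zero ι).1 hg0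
      rw [hc, ← map_one ι, ← map_sub, hc, ← map_div₀, ← map_neg] at hη
      have hη' := ι.injective hη
      refine (prim_step d _ (hprim _ h) (Or.inr ?_) v (hP _ h)).rep
      intro q hq
      refine ⟨Unit, inferInstance, fun _ => η * q, fun _ => g, 0, fun _ _ => 0, fun _ => hg0',
        fun _ _ => map_zero d, fun _ _ => rfl, ?_, ?_⟩
      · simp; ring
      · intro _ _
        refine ⟨-q, by rw [map_neg, hq, neg_zero], ?_⟩
        rw [der_mul, hq, hη']; simp

end forward
end Dilog

namespace Dilog
section converse

/-- transcendental dilogarithmic-elementary extension without new constants -/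
def Ext {F E : Type u} [Field F] [CharZero F] [Field E] [CharZero E] (d : Der F) (δ : Der E)
    (ι : F →+* E) : Prop :=
  (∀ x, δ (ι x) = ι (d x)) ∧ (∀ y, δ y = 0 → ∃ x, d x = 0 ∧ ι x = y) ∧
    ∃ (n : ℕ) (θ : Fin n → E), IsTransDilogElemTower δ ι.fieldRange θ

/-- derivative of a logarithm or dilogarithm -/
def Adm {E : Type u} [Field E] [CharZero E] (δ : Der E) (b : E) : Prop :=
  (∃ a, a ≠ 0 ∧ b = δ a / a) ∨
    (∃ g, g ≠ 0 ∧ g ≠ 1 ∧ ∃ η, δ η = -(δ (1 - g) / (1 - g)) ∧ b = (δ g / g) * η)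

lemma Adm.map {E E' : Type u} [Field E] [CharZero E] [Field E'] [CharZero E'] {δ : Der E}
    {δ' : Der E'} (j : E →+* E') (hj : ∀ x, δ' (j x) = j (δ x)) {b : E} (h : Adm δ b) :
    Adm δ' (j b) := by
  rcases h with ⟨a, ha, rfl⟩ | ⟨g, h0, h1, η, hη, rfl⟩
  · exact Or.inl ⟨j a, (map_ne_zero j).2 ha, by rw [hj, map_div₀]⟩
  · refine Or.inr ⟨j g, (map_ne_zero j).2 h0, fun h => h1 (j.injective (by rw [h, map_one])),
      j η, ?_, ?_⟩
    · rw [hj, hη, ← map_one j, ← map_sub, hj, ← map_div₀, ← map_neg]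
    · rw [hj, map_mul, map_div₀]

lemma ext_refl {F : Type u} [Field F] [CharZero F] (d : Der F) : Ext d d (RingHom.id F) := by
  refine ⟨fun _ => rfl, fun y hy => ⟨y, hy, rfl⟩, 0, Fin.elim0, fun i => i.elim0, ?_⟩
  rw [Set.range_eq_empty, Set.union_empty, Subfield.closure_eq, eq_top_iff]
  intro x _
  exact ⟨x, rfl⟩

lemma trans_map {E E' : Type u} [Field E] [Field E'] (j : E →+* E') (B : Subfield E) (t : E)
    (h : Transcendental (↥B) t) : Transcendental (↥(B.map j)) (j t) := by
  let f : B →+* B.map j := (j.comp B.subtype).codRestrict (B.map j)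
    (fun x => ⟨x.1, x.2, rfl⟩)
  refine Transcendental.ringHom_of_comp_eq (R := B) (A := E) f j h ?_ j.injective ?_
  · rintro ⟨x, y, hy, rfl⟩
    exact ⟨⟨y, hy⟩, rfl⟩
  · ext x; rfl

lemma gen_map {E E' : Type u} [Field E] [CharZero E] [Field E'] [CharZero E'] {δ : Der E}
    {δ' : Der E'} (j : E →+* E') (hj : ∀ x, δ' (j x) = j (δ x)) (B : Subfield E) (t : E)
    (h : IsTransDilogElemGen δ B t) : IsTransDilogElemGen δ' (B.map j) (j t) := by
  refine ⟨trans_map j B t h.1, ?_⟩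
  rcases h.2 with ⟨a, ha, h⟩ | ⟨a, ha, h0, h⟩ | ⟨g, hg, h0, h1, η, hη, hη', h⟩
  · exact Or.inl ⟨j a, ⟨a, ha, rfl⟩, by rw [hj, hj, h, map_mul]⟩
  · exact Or.inr (Or.inl ⟨j a, ⟨a, ha, rfl⟩, (map_ne_zero j).2 h0, by rw [hj, hj, h, map_div₀]⟩)
  · refine Or.inr (Or.inr ⟨j g, ⟨g, hg, rfl⟩, (map_ne_zero j).2 h0,
      fun h => h1 (j.injective (by rw [h, map_one])), j η, ⟨η, hη, rfl⟩, ?_, ?_⟩)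
    · rw [hj, hη', ← map_one j, ← map_sub, hj, ← map_div₀, ← map_neg]
    · rw [hj, hj, h, map_mul, map_div₀]

lemma map_closure {F E E' : Type u} [Field F] [Field E] [Field E'] (ι : F →+* E) (j : E →+* E')
    (S : Set E) : Subfield.closure (((j.comp ι).fieldRange : Set E') ∪ j '' S)
      = (Subfield.closure ((ι.fieldRange : Set E) ∪ S)).map j := by
  rw [RingHom.map_field_closure, Set.image_union]
  congr 2
  ext x
  simp

lemma ext_step {F E : Type u} [Field F] [CharZero F] [Field E] [CharZero E] (d : Der F) (δ : Der E)
    (ι : F →+* E) (h : Ext d δ ι) (b : E) (hb : Adm δ b) :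
    ∃ (E' : Type u) (_ : Field E') (_ : CharZero E') (δ' : Der E') (j : E →+* E'),
      (∀ x, δ' (j x) = j (δ x)) ∧ Ext d δ' (j.comp ι) ∧ ∃ y, δ' y = j b := by
  by_cases hy : ∃ y, δ y = b
  · exact ⟨E, inferInstance, inferInstance, δ, RingHom.id E, fun _ => rfl, h, hy⟩
  push Not at hy
  obtain ⟨dR, h1, h2, h3⟩ := ratDer_prim δ b
  obtain ⟨hc, hk, n, θ, ht⟩ := h
  refine ⟨RatFunc E, inferInstance, inferInstance, dR, RatFunc.C, h2,
    ⟨?_, ?_, n + 1, Fin.snoc (fun i => RatFunc.C (θ i)) RatFunc.X, ?_, ?_⟩, RatFunc.X, h3⟩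
  · intro x
    rw [RingHom.comp_apply, h2, hc]; rfl
  · intro y hy0
    have := h1 y
    rw [hy0, map_zero] at this
    obtain ⟨p1, p2⟩ := prim_const δ b hy _ this
    obtain ⟨x, hx, hx2⟩ := hk _ p1
    refine ⟨x, hx, (kap (F := E)).injective ?_⟩
    rw [p2, ← hx2, RingHom.comp_apply, kap, rf_C]
  · intro i
    induction i using Fin.lastCases with
    | last =>
      have hs : (Fin.snoc (fun i => RatFunc.C (θ i)) RatFunc.X : Fin (n+1) → RatFunc E) ''
          {j | j < Fin.last n} = RatFunc.C '' Set.range θ := by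
        ext x
        constructor
        · rintro ⟨k, hk, rfl⟩
          induction k using Fin.lastCases with
          | last => exact absurd (show Fin.last n < Fin.last n from hk) (lt_irrefl _)
          | cast k => exact ⟨θ k, ⟨k, rfl⟩, by simp⟩
        · rintro ⟨_, ⟨k, rfl⟩, rfl⟩
          exact ⟨k.castSucc, Fin.castSucc_lt_last k, by simp⟩
      rw [hs, map_closure, ht.2, ← RingHom.fieldRange_eq_map, Fin.snoc_last]
      refine ⟨trans_X _ rfl, Or.inr ?_⟩
      rw [h3]
      rcases hb with ⟨a, ha, rfl⟩ | ⟨g, h0, hg1, η, hη, rfl⟩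
      · exact Or.inl ⟨RatFunc.C a, ⟨a, rfl⟩, (map_ne_zero _).2 ha, by rw [h2, map_div₀]⟩
      · refine Or.inr ⟨RatFunc.C g, ⟨g, rfl⟩, (map_ne_zero _).2 h0,
          fun h => hg1 ((RatFunc.C : E →+* RatFunc E).injective (by rw [h, map_one])),
          RatFunc.C η, ⟨η, rfl⟩, ?_, ?_⟩
        · rw [h2, hη, ← map_one (RatFunc.C : E →+* RatFunc E), ← map_sub, h2, ← map_div₀,
            ← map_neg]
        · rw [h2, map_mul, map_div₀]
    | cast i =>
      have hs : (Fin.snoc (fun i => RatFunc.C (θ i)) RatFunc.X : Fin (n+1) → RatFunc E) ''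
          {j | j < i.castSucc} = RatFunc.C '' (θ '' {j | j < i}) := by
        ext x
        constructor
        · rintro ⟨k, hk, rfl⟩
          induction k using Fin.lastCases with
          | last => exact absurd (lt_trans hk (Fin.castSucc_lt_last i)) (lt_irrefl _)
          | cast k => exact ⟨θ k, ⟨k, Fin.castSucc_lt_castSucc_iff.1 hk, rfl⟩, by simp⟩
        · rintro ⟨_, ⟨k, hk, rfl⟩, rfl⟩
          exact ⟨k.castSucc, Fin.castSucc_lt_castSucc_iff.2 hk, by simp⟩
      rw [hs, map_closure, Fin.snoc_castSucc]
      exact gen_map _ h2 _ _ (ht.1 i)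
  · have hs : Set.range (Fin.snoc (fun i => RatFunc.C (θ i)) RatFunc.X : Fin (n+1) → RatFunc E)
        = RatFunc.C '' Set.range θ ∪ {RatFunc.X} := by
      ext x
      constructor
      · rintro ⟨k, rfl⟩
        induction k using Fin.lastCases with
        | last => right; simp
        | cast k => exact Or.inl ⟨θ k, ⟨k, rfl⟩, by simp⟩
      · rintro (⟨_, ⟨k, rfl⟩, rfl⟩ | rfl)
        · exact ⟨k.castSucc, by simp⟩
        · exact ⟨Fin.last n, by simp⟩
    rw [hs, ← Set.union_assoc, Subfield.closure_union, map_closure, ht.2,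
      ← RingHom.fieldRange_eq_map, ← Subfield.closure_eq (RatFunc.C : E →+* RatFunc E).fieldRange,
      ← Subfield.closure_union]
    exact rat_closure

lemma ext_fam {F : Type u} [Field F] [CharZero F] (d : Der F) (k : ℕ) :
    ∀ (E : Type u) [Field E] [CharZero E] (δ : Der E)
    (ι : F →+* E) (_ : Ext d δ ι) (b : Fin k → E) (_ : ∀ i, Adm δ (b i)),
    ∃ (E' : Type u) (_ : Field E') (_ : CharZero E') (δ' : Der E') (j : E →+* E'),
      (∀ x, δ' (j x) = j (δ x)) ∧ Ext d δ' (j.comp ι) ∧ ∃ y : Fin k → E', ∀ i, δ' (y i) = j (b i) := by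
  induction k with
  | zero =>
    intro E _ _ δ ι h b hb
    exact ⟨E, inferInstance, inferInstance, δ, RingHom.id E, fun _ => rfl, h, Fin.elim0,
      fun i => i.elim0⟩
  | succ k ih =>
    intro E _ _ δ ι h b hb
    obtain ⟨E1, _, _, δ1, j1, hj1, he1, y1, hy1⟩ := ext_step d δ ι h (b 0) (hb 0)
    obtain ⟨E2, _, _, δ2, j2, hj2, he2, y2, hy2⟩ := ih E1 δ1 (j1.comp ι) he1
      (fun i => j1 (b i.succ)) (fun i => (hb i.succ).map j1 hj1)
    refine ⟨E2, inferInstance, inferInstance, δ2, j2.comp j1, ?_, he2,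
      Fin.cons (j2 y1) y2, ?_⟩
    · intro x; simp [hj1, hj2]
    · intro i
      induction i using Fin.cases with
      | zero => simp [hj2, hy1]
      | succ i => simp [hy2]

theorem converse {F : Type u} [Field F] [CharZero F] (d : Der F) (v : F) (h : Rep d v) :
    ∃ (E : Type u) (_ : Field E) (_ : CharZero E) (δ : Der E) (ι : F →+* E),
      Ext d δ ι ∧ ∃ u, δ u = ι v := by
  obtain ⟨k, r, g, w, c, cc, hg, hcd, hcc, hsym, hv, hr⟩ := h
  have h1g : ∀ i, 1 - g i ≠ 0 := fun i => sub_ne_zero.2 (Ne.symm (hg i).2)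
  obtain ⟨E1, _, _, δ1, j1, hj1, he1, x, hx⟩ := ext_fam d k F d (RingHom.id F) (ext_refl d)
    (fun i => d (g i) / g i) (fun i => Or.inl ⟨g i, (hg i).1, rfl⟩)
  obtain ⟨E2, _, _, δ2, j2, hj2, he2, y, hy⟩ := ext_fam d k E1 δ1 _ he1
    (fun i => j1 (d (1 - g i) / (1 - g i))) (fun i => Adm.map j1 hj1 (Or.inl ⟨_, h1g i, rfl⟩))
  have hJ2 : ∀ a, δ2 (j2 (j1 a)) = j2 (j1 (d a)) := fun a => by rw [hj2, hj1]
  obtain ⟨E3, _, _, δ, j3, hj3, he3, l, hl⟩ := ext_fam d k E2 δ2 _ he2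
    (fun i => j2 (j1 (d (g i) / g i)) * (- y i)) (fun i => Or.inr
      ⟨j2 (j1 (g i)), by simpa using (hg i).1, fun h => (hg i).2
        (j1.injective (j2.injective (by rw [h, map_one, map_one]))), - y i, by
        have e : (1 : E2) - j2 (j1 (g i)) = j2 (j1 (1 - g i)) := by simp
        rw [e, map_neg, hy, hJ2]; simp, by rw [hJ2]; simp⟩)
  obtain ⟨hc, hk, ht⟩ := he3
  set ι : F →+* E3 := j3.comp ((j2.comp (j1.comp (RingHom.id F)))) with hι
  have hx' : ∀ i, δ (j3 (j2 (x i))) = ι (d (g i) / g i) := by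
    intro i; rw [hj3, hj2, hx]; rfl
  have hy' : ∀ i, δ (j3 (y i)) = ι (d (1 - g i) / (1 - g i)) := by
    intro i; rw [hj3, hy]; rfl
  have hl' : ∀ i, δ (l i) = - (ι (d (g i) / g i) * j3 (y i)) := by
    intro i; rw [hl, map_mul, map_neg, mul_neg]; rfl
  refine ⟨E3, inferInstance, inferInstance, δ, ι, ⟨hc, hk, ht⟩, ?_⟩
  generalize j3 = J3 at *
  clear hl hy hx
  obtain ⟨X, hX⟩ : ∃ X : Fin k → E3, ∀ i, X i = J3 (j2 (x i)) := ⟨_, fun i => rfl⟩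
  obtain ⟨Y, hY⟩ : ∃ Y : Fin k → E3, ∀ i, Y i = J3 (y i) := ⟨_, fun i => rfl⟩
  simp only [← hX] at hx'
  simp only [← hY] at hy' hl'
  have hcι : ∀ a, d a = 0 → δ (ι a) = 0 := fun a ha => by rw [hc, ha, map_zero]
  let K : Fin k → E3 := fun i => ι (r i) - ι (c i) * Y i - ∑ j, ι (cc i j) * X j
  have hK : ∀ i, δ (K i) = 0 := by
    intro i
    simp only [K, map_sub, map_sum]
    rw [der_const_mul δ (hcι _ (hcd i)), hy', hc, hr, map_add, map_mul, map_sum]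
    simp only [der_const_mul δ (hcι _ (hcc i _)), hx', map_mul]
    ring
  have hri : ∀ i, ι (r i) = K i + ι (c i) * Y i + ∑ j, ι (cc i j) * X j := by
    intro i; simp only [K]; ring
  have h2 : δ (1/2 : E3) = 0 := by
    rw [der_div δ _ _ two_ne_zero, der_one]
    have : δ (2:E3) = 0 := by exact_mod_cast der_int δ 2
    rw [this]; simp
  refine ⟨∑ i, (-(ι (c i) * l i) + K i * X i)
    + 1/2 * ∑ i, ∑ j, ι (cc i j) * (X i * X j) + ι w, ?_⟩
  have hq : δ (∑ i, ∑ j, ι (cc i j) * (X i * X j))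
      = 2 * ∑ i, ∑ j, ι (cc i j) * X j * ι (d (g i) / g i) := by
    simp only [map_sum, der_const_mul δ (hcι _ (hcc _ _)), der_mul, hx', mul_add,
      Finset.sum_add_distrib]
    rw [two_mul]
    congr 1
    · rw [Finset.sum_comm]
      refine Finset.sum_congr rfl fun i _ => Finset.sum_congr rfl fun j _ => ?_
      rw [hsym]; ring
    · refine Finset.sum_congr rfl fun i _ => Finset.sum_congr rfl fun j _ => ?_
      ring
  rw [map_add, map_add, der_const_mul δ h2, hq, hc, hv, map_add, map_sum, map_sum]
  congr 1
  rw [← mul_assoc, show (1/2 : E3) * 2 = 1 by norm_num, one_mul, ← Finset.sum_add_distrib]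
  refine Finset.sum_congr rfl fun i _ => ?_
  rw [map_add, map_neg, der_const_mul δ (hcι _ (hcd i)), der_const_mul δ (hK i), hl', hx', map_mul,
    hri, add_mul, Finset.sum_mul]
  ring

end converse
end Dilog


/-- Theorem 1.1: an element `v` of `F` has an antiderivative in some
transcendental dilogarithmic-elementary extension of `F` with no new constants
if and only if `v = Σ rᵢ·gᵢ'/gᵢ + w'` where
`rᵢ' = cᵢ·(1-gᵢ)'/(1-gᵢ) + Σⱼ c_{ij}·gⱼ'/gⱼ` with constants `cᵢ`, `c_{ij}`
satisfying `c_{ij} = c_{ji}`. -/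
theorem stmt12 {F : Type u} [Field F] [CharZero F] (δF : Derivation ℚ F F)
    (v : F) :
    (∃ (E : Type u) (_ : Field E) (_ : CharZero E) (δE : Derivation ℚ E E)
        (ι : F →+* E),
        (∀ x : F, δE (ι x) = ι (δF x)) ∧
        (∀ y : E, δE y = 0 → ∃ x : F, δF x = 0 ∧ ι x = y) ∧
        (∃ (n : ℕ) (θ : Fin n → E), IsTransDilogElemTower δE ι.fieldRange θ) ∧
        (∃ u : E, δE u = ι v)) ↔
      (∃ (k : ℕ) (r g : Fin k → F) (w : F) (c : Fin k → F)
          (cc : Fin k → Fin k → F),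
        (∀ i, g i ≠ 0 ∧ g i ≠ 1) ∧
        (∀ i, δF (c i) = 0) ∧ (∀ i j, δF (cc i j) = 0) ∧
        (∀ i j, cc i j = cc j i) ∧
        v = (∑ i, r i * (δF (g i) / g i)) + δF w ∧
        ∀ i, δF (r i)
          = c i * (δF (1 - g i) / (1 - g i)) + ∑ j, cc i j * (δF (g j) / g j)) := by
  constructor
  · rintro ⟨E, _, _, δE, ι, hc, hk, ⟨n, θ, ht⟩, u, hu⟩
    exact Dilog.forward δE u n F δF ι hc hk θ ht v hu
  · intro h
    obtain ⟨E, _, _, δE, ι, ⟨hc, hk, ht⟩, hu⟩ := Dilog.converse δF v h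
    exact ⟨E, inferInstance, inferInstance, δE, ι, hc, hk, ht, hu⟩
end

section
/- Let F be a differential field of characteristic zero with algebraically closed... no assumption needed: let F ⊆ E be differential fields with C_E = C_F, and suppose w ∈ E lies in a purely transcendental logarithmic extension E = F(L₁,…,Lₘ) where each Lᵢ' = hᵢ'/hᵢ with hᵢ ∈ F and L₁,…,Lₘ algebraically independent over F. If w' is a polynomial of degree at most 1 in L₁,…,Lₘ with coefficients in F, then w is a polynomial in L₁,…,Lₘ over F of total degree at most 2, of the form w = Σ_{j,q} d_{jq}·L_j·L_q + Σ_q w_q·L_q + w₀ with d_{jq} constants and w_q, w₀ ∈ F. -/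
namespace Stmt16Aux
open MvPolynomial

variable {K : Type*} [Field K] {m : ℕ}

/-- The derivation on `K[X₁,…,Xₘ]` extending `d` on coefficients with `Xᵢ ↦ ℓ i`. -/
noncomputable def D (d : K → K) (l : Fin m → K) (p : MvPolynomial (Fin m) K) :
    MvPolynomial (Fin m) K :=
  (∑ s ∈ p.support, monomial s (d (coeff s p))) + ∑ i, C (l i) * pderiv i p

lemma coeff_D (d : K → K) (hd0 : d 0 = 0) (l : Fin m → K) (p : MvPolynomial (Fin m) K)
    (s : Fin m →₀ ℕ) :
    coeff s (D d l p) = d (coeff s p) +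
      ∑ i, l i * (coeff (s + Finsupp.single i 1) p * ((s i : K) + 1)) := by
  classical
  unfold D
  rw [coeff_add, coeff_sum, coeff_sum]
  congr 1
  · simp only [coeff_monomial, Finset.sum_ite_eq', mem_support_iff]
    split_ifs with h
    · rfl
    · push Not at h
      rw [h, hd0]
  · refine Finset.sum_congr rfl fun i _ => ?_
    rw [coeff_C_mul, coeff_pderiv]

lemma coeff_zero_of_lt {p : MvPolynomial (Fin m) K} {s : Fin m →₀ ℕ}
    (h : p.totalDegree < s.degree) : coeff s p = 0 := by
  by_contra hne
  have := le_totalDegree (mem_support_iff.2 hne)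
  rw [Finsupp.degree_eq_sum] at h
  rw [Finsupp.sum_fintype _ _ (by simp)] at this
  omega

lemma exists_top {p : MvPolynomial (Fin m) K} (hp : p ≠ 0) :
    ∃ s, coeff s p ≠ 0 ∧ s.degree = p.totalDegree := by
  obtain ⟨s, hs, h⟩ := Finset.exists_mem_eq_sup p.support (support_nonempty.2 hp)
    (fun s => s.sum fun _ e => e)
  refine ⟨s, mem_support_iff.1 hs, ?_⟩
  rw [totalDegree, h, Finsupp.degree_eq_sum, Finsupp.sum_fintype _ _ (by simp)]

lemma coeff_D_top (d : K → K) (hd0 : d 0 = 0) (l : Fin m → K) (p : MvPolynomial (Fin m) K)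
    (s : Fin m →₀ ℕ) (hs : p.totalDegree ≤ s.degree) :
    coeff s (D d l p) = d (coeff s p) := by
  rw [coeff_D d hd0, Finset.sum_eq_zero, add_zero]
  intro i _
  rw [coeff_zero_of_lt (s := s + Finsupp.single i 1), zero_mul, mul_zero]
  simp
  omega

lemma totalDegree_D (d : K → K) (hd0 : d 0 = 0) (l : Fin m → K) (p : MvPolynomial (Fin m) K) :
    (D d l p).totalDegree ≤ p.totalDegree := by
  by_cases h : D d l p = 0
  · simp [h]
  obtain ⟨s, hs, hd⟩ := exists_top h
  by_contra hlt
  push Not at hlt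
  apply hs
  rw [coeff_D_top d hd0 l p s (by omega), coeff_zero_of_lt (by omega), hd0]

lemma D_add (d : K → K) (hd0 : d 0 = 0) (hda : ∀ x y, d (x + y) = d x + d y) (l : Fin m → K)
    (p q : MvPolynomial (Fin m) K) : D d l (p + q) = D d l p + D d l q := by
  ext s
  simp only [coeff_add, coeff_D d hd0, hda, add_mul, mul_add, Finset.sum_add_distrib]
  ring

lemma D_C (d : K → K) (hd0 : d 0 = 0) (l : Fin m → K) (c : K) :
    D d l (C c) = C (d c) := by
  classical
  unfold D
  by_cases hc : c = 0
  · simp [hc, hd0]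
  · simp [support_C, hc]

lemma D_mul_X (d : K → K) (l : Fin m → K)
    (p : MvPolynomial (Fin m) K) (i : Fin m) :
    D d l (p * X i) = D d l p * X i + p * C (l i) := by
  classical
  have h1 : ∑ s ∈ (p * X i).support, monomial s (d (coeff s (p * X i))) =
      (∑ s ∈ p.support, monomial s (d (coeff s p))) * X i := by
    rw [support_mul_X, Finset.sum_map, Finset.sum_mul]
    refine Finset.sum_congr rfl fun s _ => ?_
    simp [X, monomial_mul]
  have h2 : ∑ j, C (l j) * pderiv j (p * X i) =
      (∑ j, C (l j) * pderiv j p) * X i + p * C (l i) := by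
    simp only [Derivation.leibniz, pderiv_X, smul_eq_mul, mul_add, Finset.sum_add_distrib,
      Finset.sum_mul]
    rw [Finset.sum_eq_single i]
    · simp
      rw [add_comm, mul_comm (C (l i)) p]
      congr 1
      exact Finset.sum_congr rfl fun _ _ => by ring
    · intro j _ hj
      simp [hj.symm]
    · simp
  unfold D
  rw [h1, h2]
  ring


/-- The target shape. -/
def Good {E : Type*} [Field E] [CharZero E] (δ : Derivation ℚ E E) (F : Subfield E) (L : Fin m → E)
    (w : E) : Prop :=
  ∃ (d : Fin m → Fin m → E) (wq : Fin m → E) (w₀ : E),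
      (∀ j q, δ (d j q) = 0) ∧ (∀ q, wq q ∈ F) ∧ w₀ ∈ F ∧
      w = (∑ j, ∑ q, d j q * L j * L q) + (∑ q, wq q * L q) + w₀

section
variable {E : Type*} [Field E] [CharZero E] (δ : Derivation ℚ E E) (F : Subfield E) (L : Fin m → E)

lemma Good.add {x y : E} (hx : Good δ F L x) (hy : Good δ F L y) : Good δ F L (x + y) := by
  obtain ⟨d, wq, w₀, h1, h2, h3, rfl⟩ := hx
  obtain ⟨d', wq', w₀', h1', h2', h3', rfl⟩ := hy
  refine ⟨fun j q => d j q + d' j q, fun q => wq q + wq' q, w₀ + w₀', ?_, ?_, ?_, ?_⟩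
  · intro j q
    rw [map_add, h1, h1', add_zero]
  · exact fun q => F.add_mem (h2 q) (h2' q)
  · exact F.add_mem h3 h3'
  · simp only [add_mul, Finset.sum_add_distrib]
    ring

lemma good_zero : Good δ F L 0 :=
  ⟨fun _ _ => 0, fun _ => 0, 0, by simp, fun _ => F.zero_mem, F.zero_mem, by simp⟩

lemma good_const {c : E} (hc : c ∈ F) : Good δ F L c :=
  ⟨fun _ _ => 0, fun _ => 0, c, by simp, fun _ => F.zero_mem, hc, by simp⟩

lemma good_lin {c : E} (hc : c ∈ F) (i : Fin m) : Good δ F L (c * L i) := by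
  classical
  refine ⟨fun _ _ => 0, fun j => if j = i then c else 0, 0, by simp, fun q => ?_,
    F.zero_mem, by simp⟩
  dsimp only
  split_ifs
  · exact hc
  · exact F.zero_mem

lemma good_quad {c : E} (hc : δ c = 0) (i j : Fin m) : Good δ F L (c * L i * L j) := by
  classical
  refine ⟨fun a b => if a = i then (if b = j then c else 0) else 0, fun _ => 0, 0,
    fun a b => ?_, fun q => F.zero_mem, F.zero_mem, ?_⟩
  · dsimp only
    split_ifs <;> simp [hc]
  · rw [Finset.sum_eq_single i, Finset.sum_eq_single j]
    · simp
    · intro b _ hb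
      simp [hb]
    · simp
    · intro b _ hb
      simp [hb]
    · simp

end

lemma exists_split {s : Fin m →₀ ℕ} (hs : s ≠ 0) :
    ∃ i t, s = t + Finsupp.single i 1 := by
  obtain ⟨i, hi⟩ := Finsupp.ne_iff.1 hs
  refine ⟨i, s - Finsupp.single i 1, ?_⟩
  rw [tsub_add_cancel_of_le]
  rw [Finsupp.single_le_iff]
  simp at hi
  omega

end Stmt16Aux

open MvPolynomial Stmt16Aux in
/-- Structure of antiderivatives in a purely transcendental logarithmic
extension `E = F(L₁,…,Lₘ)` (each `Lᵢ` a logarithm of an element of `F`, the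
`Lᵢ` algebraically independent over `F`, no new constants): if `w ∈ E` has
derivative a polynomial of degree at most `1` in the `Lᵢ` with coefficients in
`F`, then `w = Σ d_{jq}·L_j·L_q + Σ w_q·L_q + w₀` with the `d_{jq}` constants
and `w_q, w₀ ∈ F`. -/
theorem stmt16 {E : Type*} [Field E] [CharZero E] (δ : Derivation ℚ E E)
    (F : Subfield E) (hFδ : ∀ y ∈ F, δ y ∈ F)
    {m : ℕ} (L : Fin m → E) (h : Fin m → E)
    (hh : ∀ i, h i ∈ F ∧ h i ≠ 0)
    (hL : ∀ i, δ (L i) = δ (h i) / h i)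
    (hind : AlgebraicIndependent (↥F) L)
    (hgen : Subfield.closure ((F : Set E) ∪ Set.range L) = ⊤)
    (hconst : ∀ y : E, δ y = 0 → y ∈ F)
    (w : E) (a : Fin m → E) (b : E)
    (haF : ∀ i, a i ∈ F) (hbF : b ∈ F)
    (hw : δ w = (∑ i, a i * L i) + b) :
    ∃ (d : Fin m → Fin m → E) (wq : Fin m → E) (w₀ : E),
      (∀ j q, δ (d j q) = 0) ∧ (∀ q, wq q ∈ F) ∧ w₀ ∈ F ∧
      w = (∑ j, ∑ q, d j q * L j * L q) + (∑ q, wq q * L q) + w₀ := by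
  classical
  -- the derivation on `F`
  let d : F → F := fun y => ⟨δ y, hFδ y y.2⟩
  have hdc : ∀ y : F, ((d y : F) : E) = δ y := fun _ => rfl
  have hd0 : d 0 = 0 := Subtype.ext (by simp [d])
  have hd1 : d 1 = 0 := Subtype.ext (by simp [d])
  have hda : ∀ x y, d (x + y) = d x + d y := fun x y => Subtype.ext (by simp [d])
  let l : Fin m → F := fun i => ⟨δ (L i), by
    rw [hL]; exact F.div_mem (hFδ _ (hh i).1) (hh i).1⟩
  have hlc : ∀ i, ((l i : F) : E) = δ (L i) := fun _ => rfl
  let φ : MvPolynomial (Fin m) F →ₐ[F] E := aeval L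
  have hinj : Function.Injective φ := hind
  have hφC : ∀ c : F, φ (C c) = (c : E) := fun c => by
    simp only [φ, aeval_C]; rfl
  have hφX : ∀ i, φ (X i) = L i := fun i => aeval_X _ _
  have hφD : ∀ p, φ (D d l p) = δ (φ p) := by
    intro p
    induction p using MvPolynomial.induction_on with
    | C c => rw [D_C d hd0, hφC, hφC]
    | add p q hp hq => rw [D_add d hd0 hda, map_add, map_add, map_add, hp, hq]
    | mul_X p i hp =>
      rw [D_mul_X, map_add, map_mul, map_mul, map_mul, hp, hφC, hφX, Derivation.leibniz,
        hlc, smul_eq_mul, smul_eq_mul]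
      ring
  -- `w'` as a polynomial
  let R : MvPolynomial (Fin m) F := (∑ i, C ⟨a i, haF i⟩ * X i) + C ⟨b, hbF⟩
  have hR : φ R = δ w := by
    rw [hw]
    simp only [R, map_add, map_sum, map_mul, hφC, hφX]
  have hR2 : ∀ s : Fin m →₀ ℕ, 2 ≤ s.degree → coeff s R = 0 := by
    intro s hs
    apply coeff_zero_of_lt
    refine lt_of_le_of_lt ?_ hs
    refine (totalDegree_add _ _).trans (max_le ?_ (by simp))
    refine totalDegree_finsetSum_le fun i _ => ?_
    refine (totalDegree_mul _ _).trans ?_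
    simp
  -- `w` is a fraction
  have hfrac : ∃ P Q, Q ≠ 0 ∧ w * φ Q = φ P := by
    have hmem : w ∈ Subfield.closure ((F : Set E) ∪ Set.range L) := by
      rw [hgen]; trivial
    have hle : Subring.closure ((F : Set E) ∪ Set.range L) ≤ φ.toRingHom.range := by
      rw [Subring.closure_le]
      rintro x (hx | ⟨i, rfl⟩)
      · exact ⟨C ⟨x, hx⟩, hφC _⟩
      · exact ⟨X i, hφX i⟩
    obtain ⟨y, hy, z, hz, rfl⟩ := Subfield.mem_closure_iff.1 hmem
    obtain ⟨P, rfl⟩ := hle hy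
    obtain ⟨Q, rfl⟩ := hle hz
    by_cases hQ : Q = 0
    · exact ⟨0, 1, one_ne_zero, by simp [hQ]⟩
    · refine ⟨P, Q, hQ, ?_⟩
      have : φ Q ≠ 0 := fun h0 => hQ (hinj (by rw [h0, map_zero]))
      exact div_mul_cancel₀ _ this
  -- `w` is a polynomial
  have hpoly : ∃ p, φ p = w := by
    obtain ⟨P₀, Q₀, hQ₀, hPQ₀⟩ := hfrac
    obtain ⟨P, Q, G, hrel, rfl, rfl⟩ :=
      UniqueFactorizationMonoid.exists_reduced_factors' P₀ Q₀ hQ₀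
    have hG : φ G ≠ 0 := fun h0 => hQ₀ (by
      rw [hinj (h0.trans (map_zero φ).symm), zero_mul])
    have hQ : Q ≠ 0 := right_ne_zero_of_mul hQ₀
    have hPQ : w * φ Q = φ P := by
      rw [map_mul, map_mul] at hPQ₀
      apply mul_left_cancel₀ hG
      rw [← hPQ₀]; ring
    obtain ⟨s, hs, hdeg⟩ := exists_top hQ
    set c := coeff s Q with hc
    obtain ⟨Q1, hQ1⟩ : ∃ Q1, Q1 = C c⁻¹ * Q := ⟨_, rfl⟩
    obtain ⟨P1, hP1⟩ : ∃ P1, P1 = C c⁻¹ * P := ⟨_, rfl⟩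
    have hcc : (C c * C c⁻¹ : MvPolynomial (Fin m) F) = 1 := by
      rw [← C_mul, mul_inv_cancel₀ hs, C_1]
    have hQQ : Q = C c * Q1 := by rw [hQ1, ← mul_assoc, hcc, one_mul]
    have hPP : P = C c * P1 := by rw [hP1, ← mul_assoc, hcc, one_mul]
    have hrel1 : IsRelPrime Q1 P1 := fun x hxQ hxP =>
      hrel (hxP.trans ⟨C c, by rw [hPP]; ring⟩) (hxQ.trans ⟨C c, by rw [hQQ]; ring⟩)
    have hQ10 : Q1 ≠ 0 := by
      rintro h0
      rw [h0, mul_zero] at hQQ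
      exact hQ hQQ
    have hPQ1 : w * φ Q1 = φ P1 := by
      rw [hQ1, hP1, map_mul, map_mul, ← hPQ]; ring
    have hs1 : coeff s Q1 = 1 := by
      rw [hQ1, coeff_C_mul, ← hc, inv_mul_cancel₀ hs]
    have hdeg1 : Q1.totalDegree ≤ s.degree := by
      rw [hdeg, hQ1]
      refine (totalDegree_mul _ _).trans ?_
      simp
    have hder : R * Q1 * Q1 + P1 * D d l Q1 = D d l P1 * Q1 := by
      apply hinj
      simp only [map_add, map_mul, hφD, hR]
      rw [← hPQ1, Derivation.leibniz, smul_eq_mul, smul_eq_mul]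
      ring
    have hdvd : Q1 ∣ D d l Q1 := by
      apply hrel1.dvd_of_dvd_mul_left
      exact ⟨D d l P1 - R * Q1, by linear_combination hder⟩
    have hDQ : D d l Q1 = 0 := by
      by_contra hne
      obtain ⟨f, hf⟩ := hdvd
      have hf0 : f ≠ 0 := by
        rintro rfl
        exact hne (by rw [hf, mul_zero])
      have h1 := totalDegree_D d hd0 l Q1
      rw [hf, totalDegree_mul_of_isDomain hQ10 hf0] at h1
      have h2 : f.totalDegree = 0 := by omega
      rw [totalDegree_eq_zero_iff_eq_C] at h2
      have h3 := coeff_D_top d hd0 l Q1 s hdeg1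
      rw [hs1, hd1, hf, h2, mul_comm, coeff_C_mul, hs1, mul_one] at h3
      exact hf0 (by rw [h2, h3, C_0])
    have hF : φ Q1 ∈ F := hconst _ (by rw [← hφD, hDQ, map_zero])
    have hne : φ Q1 ≠ 0 := fun h0 => hQ10 (hinj (by rw [h0, map_zero]))
    refine ⟨C (⟨φ Q1, hF⟩⁻¹) * P1, ?_⟩
    rw [map_mul, hφC, ← hPQ1]
    change (φ Q1)⁻¹ * (w * φ Q1) = w
    field_simp
  obtain ⟨p, hp⟩ := hpoly
  have hDp : D d l p = R := hinj (by rw [hφD, hR, hp])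
  have hcst : ∀ s : Fin m →₀ ℕ, 2 ≤ s.degree → p.totalDegree ≤ s.degree →
      δ (coeff s p : F) = 0 := by
    intro s h2 hs
    have := coeff_D_top d hd0 l p s hs
    rw [hDp, hR2 s h2] at this
    rw [← hdc, ← this]; rfl
  -- the degree is at most 2
  have hdeg2 : p.totalDegree ≤ 2 := by
    by_contra hlt
    push Not at hlt
    have hp0 : p ≠ 0 := by
      rintro rfl
      simp at hlt
    obtain ⟨s, hs, hdeg⟩ := exists_top hp0
    have hs0 : s ≠ 0 := by
      rintro rfl
      simp at hdeg
      omega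
    obtain ⟨i, t, rfl⟩ := exists_split hs0
    have htd : t.degree + 1 = p.totalDegree := by
      rw [← hdeg]; simp
    have hco := coeff_D d hd0 l p t
    rw [hDp, hR2 t (by omega)] at hco
    let q : MvPolynomial (Fin m) F := C (coeff t p) +
      ∑ j, C (coeff (t + Finsupp.single j 1) p * ((t j : F) + 1)) * X j
    have hq : δ (φ q) = 0 := by
      have h0 := congrArg (fun x : F => (x : E)) hco
      simp only [q, map_add, map_sum, map_mul, hφC, hφX, Derivation.leibniz, smul_eq_mul]
      push_cast at h0
      rw [hdc] at h0
      rw [h0]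
      congr 1
      refine Finset.sum_congr rfl fun j _ => ?_
      have h1 : δ (coeff (t + Finsupp.single j 1) p : F) = 0 := by
        apply hcst <;> simp <;> omega
      have h2 : δ ((t j : E) + 1) = 0 := by simp
      push_cast
      rw [hlc]
      simp only [Derivation.leibniz, smul_eq_mul, h1, h2, map_mul, map_add]
      simp [h1]
      ring
    have hqF := hconst _ hq
    have hqC : q = C ⟨φ q, hqF⟩ := hinj (by rw [hφC])
    have hci := congrArg (coeff (Finsupp.single i 1)) hqC
    rw [coeff_C, if_neg (by
      intro h0
      have := DFunLike.congr_fun h0 i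
      simp at this)] at hci
    simp only [q, coeff_add, coeff_sum, coeff_C_mul] at hci
    rw [coeff_C, if_neg (by
      intro h0
      have := DFunLike.congr_fun h0 i
      simp at this), Finset.sum_eq_single i] at hci
    · rw [coeff_X, if_pos rfl, mul_one, zero_add] at hci
      rcases mul_eq_zero.1 hci with h0 | h0
      · exact hs h0
      · exact Nat.cast_add_one_ne_zero (t i) h0
    · intro j _ hj
      rw [coeff_X, if_neg, mul_zero]
      intro h0
      exact hj (Finsupp.single_left_injective one_ne_zero h0)
    · simp
  -- conclusion
  change Good δ F L w
  rw [← hp, p.as_sum, map_sum]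
  refine Finset.sum_induction _ (Good δ F L) (fun _ _ => Good.add δ F L) (good_zero δ F L) ?_
  intro s hs
  have hsd : s.degree ≤ 2 := by
    by_contra hlt
    exact mem_support_iff.1 hs (coeff_zero_of_lt (by omega))
  have hcst' := hcst s
  generalize coeff s p = c at hcst'
  by_cases h0 : s = 0
  · subst h0
    have : φ (monomial 0 c) = (c : E) := hφC c
    rw [this]
    exact good_const δ F L c.2
  obtain ⟨i, t, rfl⟩ := exists_split h0
  by_cases h1 : t = 0
  · subst h1
    have : φ (monomial (0 + Finsupp.single i 1) c) = (c : E) * L i := by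
      rw [monomial_add_single, pow_one, map_mul, hφX]
      exact congrArg (· * L i) (hφC c)
    rw [this]
    exact good_lin δ F L c.2 i
  obtain ⟨j, u, rfl⟩ := exists_split h1
  have hu : u = 0 := by
    rw [← Finsupp.degree_eq_zero_iff]
    simp at hsd
    omega
  subst hu
  have : φ (monomial (0 + Finsupp.single j 1 + Finsupp.single i 1) c) =
      (c : E) * L j * L i := by
    rw [monomial_add_single, pow_one, map_mul, hφX, monomial_add_single, pow_one, map_mul, hφX]
    exact congrArg (· * L j * L i) (hφC c)
  rw [this]
  refine good_quad δ F L (hcst' ?_ ?_) j i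
  · simp
  · simpa using hdeg2
end
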